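/- Let β > 1 be a real number. There exists a constant σ > 0 (depending only on β) such that for every y ∈ ℝ, the Lebesgue measure of the set {x ∈ [0,1) : (k_n(x) − (6·log 2·log β/π²)·n)/(σ·√n) ≤ y} converges, as n → ∞, to (1/√(2π)) ∫_{−∞}^{y} e^{−t²/2} dt. -/

import Mathlib

open MeasureTheory Filter Set

/-- The β-transformation `T_β x = βx - ⌊βx⌋` on `[0,1)`. -/
noncomputable def betaT (β : ℝ) (x : ℝ) : ℝ := β * x - ⌊β * x⌋

/-- The `i`-th digit (for `i ≥ 1`) of the β-expansion of `x`. -/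
noncomputable def betaEps (β : ℝ) (i : ℕ) (x : ℝ) : ℤ := ⌊β * (betaT β)^[i - 1] x⌋

/-- The cylinder of order `n` of the β-expansion containing `x`. -/
def betaCyl (β : ℝ) (n : ℕ) (x : ℝ) : Set ℝ :=
  {y ∈ Set.Ico (0:ℝ) 1 | ∀ i, 1 ≤ i → i ≤ n → betaEps β i y = betaEps β i x}

/-- The Gauss map, with `T 0 = 0`. -/
noncomputable def gaussMap (x : ℝ) : ℝ := if x = 0 then 0 else 1 / x - ⌊1 / x⌋

/-- The `i`-th partial quotient (for `i ≥ 1`) of the continued fraction expansion of `x`. -/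
noncomputable def cfA (i : ℕ) (x : ℝ) : ℤ := ⌊1 / (gaussMap^[i - 1] x)⌋

/-- The cylinder of order `m` of the continued fraction expansion containing `x`. -/
def cfCyl (m : ℕ) (x : ℝ) : Set ℝ :=
  {y ∈ Set.Ico (0:ℝ) 1 | ∀ i, 1 ≤ i → i ≤ m → cfA i y = cfA i x}

/-- `k_n(x)`: the exact number of partial quotients of the continued fraction of `x`
determined by the first `n` β-expansion digits of `x`. -/
noncomputable def kCF (β : ℝ) (n : ℕ) (x : ℝ) : ℕ :=
  sSup {m | betaCyl β n x ⊆ cfCyl m x}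

/-- Denominators `q_n(x)` of the continued fraction convergents of `x`
(`q_0 = 1`, `q_1 = a_1`, `q_n = a_n q_{n-1} + q_{n-2}`). -/
noncomputable def cfQ (x : ℝ) : ℕ → ℤ
  | 0 => 1
  | 1 => cfA 1 x
  | (n + 2) => cfA (n + 2) x * cfQ x (n + 1) + cfQ x n

/-- Numerators `p_n(x)` of the continued fraction convergents of `x`
(`p_0 = 0`, `p_1 = 1`, `p_n = a_n p_{n-1} + p_{n-2}`). -/
noncomputable def cfP (x : ℝ) : ℕ → ℤ
  | 0 => 0
  | 1 => 1
  | (n + 2) => cfA (n + 2) x * cfP x (n + 1) + cfP x n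

/-- `l_n(x)`: the length of the longest string of zeros just after the `n`-th digit
of the β-expansion of `x`. -/
noncomputable def lZero (β : ℝ) (n : ℕ) (x : ℝ) : ℕ :=
  sSup {k | ∀ j, 1 ≤ j → j ≤ k → betaEps β (n + j) x = 0}


namespace KnCLT

lemma exp1 (θ : ℝ) : ‖Complex.exp (Complex.I * θ) - 1‖ ≤ |θ| := by
  simpa using Real.norm_exp_I_mul_ofReal_sub_one_le (x := θ)

lemma hasDeriv_e (θ : ℝ) : HasDerivAt (fun θ : ℝ => Complex.exp (Complex.I * θ))
    (Complex.I * Complex.exp (Complex.I * θ)) θ := by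
  have h : HasDerivAt (fun θ : ℝ => Complex.I * (θ:ℂ)) (Complex.I * 1) θ :=
    (Complex.ofRealCLM.hasDerivAt (x := θ)).const_mul Complex.I
  have := h.cexp
  convert this using 1
  ring

lemma mvt0 (g g' : ℝ → ℂ) (hg : ∀ θ, HasDerivAt g (g' θ) θ) (h0 : g 0 = 0) (k : ℕ)
    (hb : ∀ θ, ‖g' θ‖ ≤ |θ| ^ k) (θ : ℝ) : ‖g θ‖ ≤ |θ| ^ (k+1) := by
  have := Convex.norm_image_sub_le_of_norm_hasDerivWithin_le (f := g) (f' := g')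
    (s := Set.Icc (-|θ|) |θ|) (C := |θ| ^ k) (x := 0) (y := θ)
    (fun x _ => (hg x).hasDerivWithinAt)
    (fun x hx => (hb x).trans (pow_le_pow_left₀ (abs_nonneg _) (abs_le.2 hx) k))
    (convex_Icc _ _) (by simp) (abs_le.1 le_rfl)
  rw [h0] at this
  simpa [pow_succ] using this

lemma exp2 (θ : ℝ) : ‖Complex.exp (Complex.I * θ) - 1 - Complex.I * θ‖ ≤ |θ| ^ 2 := by
  refine mvt0 (fun θ : ℝ => Complex.exp (Complex.I * θ) - 1 - Complex.I * θ)
    (fun θ => Complex.I * Complex.exp (Complex.I * θ) - Complex.I * 1) (fun θ => ?_) (by simp) 1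
    (fun θ => ?_) θ
  · exact ((hasDeriv_e θ).sub_const 1).sub
      ((Complex.ofRealCLM.hasDerivAt (x := θ)).const_mul Complex.I)
  · rw [← mul_sub, norm_mul]; simpa using exp1 θ

lemma exp3 (θ : ℝ) : ‖Complex.exp (Complex.I * θ) - 1 - Complex.I * θ + θ ^ 2 / 2‖ ≤ |θ| ^ 3 := by
  refine mvt0 (fun θ : ℝ => Complex.exp (Complex.I * θ) - 1 - Complex.I * θ + (θ:ℂ) ^ 2 / 2)
    (fun θ => Complex.I * Complex.exp (Complex.I * θ) - Complex.I * 1 + θ) (fun θ => ?_) (by simp) 2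
    (fun θ => ?_) θ
  · refine (((hasDeriv_e θ).sub_const 1).sub
      ((Complex.ofRealCLM.hasDerivAt (x := θ)).const_mul Complex.I)).add ?_
    have h := ((Complex.ofRealCLM.hasDerivAt (x := θ)).pow 2).div_const 2
    have e : ((θ:ℝ):ℂ) = (((2:ℕ):ℂ) * (Complex.ofRealCLM θ) ^ (2 - 1) * Complex.ofRealCLM 1) / 2 := by
      simp
    rw [e]
    exact h
  · have : Complex.I * Complex.exp (Complex.I * θ) - Complex.I * 1 + θ
      = Complex.I * (Complex.exp (Complex.I * θ) - 1 - Complex.I * θ) := by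
      linear_combination ((θ:ℂ)) * Complex.I_mul_I
    rw [this, norm_mul]; simpa using exp2 θ

lemma remainder (t f b c B : ℝ) (hb : |b| ≤ B) (hc : |c| ≤ B) :
    ‖Complex.exp (Complex.I * ((t * f : ℝ) : ℂ)) * (1 + Complex.I * t * b + t ^ 2 * c) -
      (1 + Complex.I * t * ((f + b : ℝ) : ℂ) + t ^ 2 * ((c - f ^ 2 / 2 - f * b : ℝ) : ℂ))‖
      ≤ |t| ^ 3 * (|f| ^ 3 + B * |f| ^ 2 + B * |f|) := by
  have e : Complex.exp (Complex.I * ((t * f : ℝ) : ℂ)) * (1 + Complex.I * t * b + t ^ 2 * c) -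
      (1 + Complex.I * t * ((f + b : ℝ) : ℂ) + t ^ 2 * ((c - f ^ 2 / 2 - f * b : ℝ) : ℂ)) =
      (Complex.exp (Complex.I * ((t * f : ℝ) : ℂ)) - 1 - Complex.I * ((t * f : ℝ) : ℂ)
        + ((t * f : ℝ) : ℂ) ^ 2 / 2) +
      (Complex.I * t * b) * (Complex.exp (Complex.I * ((t * f : ℝ) : ℂ)) - 1
        - Complex.I * ((t * f : ℝ) : ℂ)) +
      (t ^ 2 * c) * (Complex.exp (Complex.I * ((t * f : ℝ) : ℂ)) - 1) := by
    push_cast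
    linear_combination ((t:ℂ) ^ 2 * b * f) * Complex.I_mul_I
  rw [e]
  have h1 := exp3 (t * f)
  have h2 := exp2 (t * f)
  have h3 := exp1 (t * f)
  refine (norm_add₃_le).trans ?_
  rw [norm_mul (Complex.I * t * b), norm_mul ((t:ℂ) ^ 2 * c)]
  have n1 : ‖Complex.I * t * b‖ ≤ |t| * B := by
    simp only [norm_mul, Complex.norm_I, one_mul, Complex.norm_real, Real.norm_eq_abs]
    gcongr
  have n2 : ‖(t:ℂ) ^ 2 * c‖ ≤ |t| ^ 2 * B := by
    simp only [norm_mul, norm_pow, Complex.norm_real, Real.norm_eq_abs]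
    gcongr
  have hB : 0 ≤ B := (abs_nonneg _).trans hb
  calc _ ≤ |t * f| ^ 3 + (|t| * B) * |t * f| ^ 2 + (|t| ^ 2 * B) * |t * f| := by gcongr
    _ = _ := by rw [abs_mul]; ring

variable {Ω : Type*} [MeasurableSpace Ω]

/-- bounded times integrable -/
lemma int_bdd_mul {μ : Measure Ω} [IsProbabilityMeasure μ] {F G : Ω → ℂ}
    (hF : Integrable F μ) (hG : Measurable G) {C : ℝ} (hC : ∀ x, ‖G x‖ ≤ C) :
    Integrable (fun x => F x * G x) μ :=
  hF.mul_bdd (c := C) hG.aestronglyMeasurable (Eventually.of_forall hC)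

theorem charfun_conv (μ : Measure Ω) [IsProbabilityMeasure μ] (T : Ω → Ω)
    (hT : MeasurePreserving T μ μ) (f b c d ρ : Ω → ℝ) (mf : Measurable f) (mb : Measurable b)
    (mc : Measurable c) (md : Measurable d) (mρ : Measurable ρ)
    (hf3 : Integrable (fun x => |f x| ^ 3) μ) (B : ℝ) (hb : ∀ x, |b x| ≤ B) (hc : ∀ x, |c x| ≤ B)
    (hd : ∀ x, |d x| ≤ B) (hρ : Integrable ρ μ) (v : ℝ) (hv : 0 ≤ v)
    (D1 : ∀ G : Ω → ℂ, Measurable G → (∀ x, ‖G x‖ ≤ 1) →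
      ∫ x, ((f x + b x : ℝ) : ℂ) * G (T x) ∂μ = ∫ x, (b x : ℂ) * G x ∂μ)
    (D2 : ∀ G : Ω → ℂ, Measurable G → (∀ x, ‖G x‖ ≤ 1) →
      ∫ x, ((c x - f x ^ 2 / 2 - f x * b x : ℝ) : ℂ) * G (T x) ∂μ
        = ∫ x, ((c x - v / 2 : ℝ) : ℂ) * G x ∂μ)
    (D3 : ∀ G : Ω → ℂ, Measurable G → (∀ x, ‖G x‖ ≤ 1) →
      ∫ x, ((ρ x - 1 : ℝ) : ℂ) * G x ∂μ
        = ∫ x, (d x : ℂ) * G x ∂μ - ∫ x, (d x : ℂ) * G (T x) ∂μ) (s : ℝ) :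
    Tendsto (fun n : ℕ => ∫ x, (ρ x : ℂ) *
      Complex.exp (Complex.I * ((s / Real.sqrt n * birkhoffSum T f n x : ℝ) : ℂ)) ∂μ) atTop
      (nhds (Complex.exp (-(v * s ^ 2 / 2 : ℝ)))) := by
  have hT' := hT.measurable
  have hB : 0 ≤ B := by
    obtain ⟨x⟩ : Nonempty Ω := by
      by_contra h
      rw [not_nonempty_iff] at h
      have := measure_univ (μ := μ)
      rw [Set.eq_empty_of_isEmpty (Set.univ : Set Ω)] at this
      simp at this
    exact (abs_nonneg _).trans (hb x)
  -- integrability of powers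
  have if2 : Integrable (fun x => |f x| ^ 2) μ := by
    refine Integrable.mono' ((integrable_const (1:ℝ)).add hf3) (by fun_prop) ?_
    refine Eventually.of_forall fun x => ?_
    simp only [Pi.add_apply, norm_pow, Real.norm_eq_abs, abs_abs]
    have := abs_nonneg (f x)
    rcases le_total (|f x|) 1 with h | h
    · nlinarith [pow_le_one₀ (n := 2) this h, pow_nonneg this 3]
    · nlinarith [pow_le_pow_right₀ h (show 2 ≤ 3 by norm_num)]
  have if1a : Integrable (fun x => |f x|) μ := by
    refine Integrable.mono' ((integrable_const (1:ℝ)).add hf3) (by fun_prop) ?_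
    refine Eventually.of_forall fun x => ?_
    simp only [Pi.add_apply, Real.norm_eq_abs, abs_abs]
    have := abs_nonneg (f x)
    rcases le_total (|f x|) 1 with h | h
    · nlinarith [pow_nonneg this 3]
    · nlinarith [pow_le_pow_right₀ h (show 1 ≤ 3 by norm_num)]
  have if1 : Integrable f μ := (integrable_norm_iff (by fun_prop)).1 (by simpa using if1a)
  have if2' : Integrable (fun x => f x ^ 2) μ := by simpa using if2
  have ib : Integrable b μ := Integrable.mono' (integrable_const B) (by fun_prop)
    (Eventually.of_forall hb)
  have ic : Integrable c μ := Integrable.mono' (integrable_const B) (by fun_prop)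
    (Eventually.of_forall hc)
  have id : Integrable d μ := Integrable.mono' (integrable_const B) (by fun_prop)
    (Eventually.of_forall hd)
  have ifb : Integrable (fun x => f x * b x) μ :=
    if1.mul_bdd (c := B) (by fun_prop) (Eventually.of_forall hb)
  let S : ℕ → Ω → ℝ := fun n => birkhoffSum T f n
  have mS : ∀ n, Measurable (S n) := by
    intro n
    simp only [S, birkhoffSum]
    unfold birkhoffSum
    exact Finset.measurable_sum _ (fun i _ => mf.comp (hT'.iterate i))
  let E : ℝ → ℕ → Ω → ℂ := fun t n x => Complex.exp (Complex.I * ((t * S n x : ℝ) : ℂ))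
  have mE : ∀ t n, Measurable (E t n) := by
    intro t n
    have := mS n
    simp only [E]
    fun_prop
  have nE : ∀ t n x, ‖E t n x‖ = 1 := by
    intro t n x
    simp only [E]
    rw [mul_comm, Complex.norm_exp_ofReal_mul_I]
  have nE' : ∀ t n x, ‖E t n x‖ ≤ 1 := fun t n x => (nE t n x).le
  have Esucc : ∀ t n x, E t (n+1) x = Complex.exp (Complex.I * ((t * f x : ℝ) : ℂ)) * E t n (T x) := by
    intro t n x
    simp only [E, S, birkhoffSum_succ']
    rw [← Complex.exp_add]
    push_cast
    ring_nf
  let u : ℝ → Ω → ℂ := fun t x => 1 + Complex.I * t * b x + t ^ 2 * c x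
  have iu : ∀ t, Integrable (u t) μ := by
    intro t
    exact ((integrable_const (1:ℂ)).add (ib.ofReal.const_mul _)).add (ic.ofReal.const_mul _)
  let A : ℝ → ℕ → ℂ := fun t n => ∫ x, u t x * E t n x ∂μ
  let K : ℝ := ∫ x, (|f x| ^ 3 + B * |f x| ^ 2 + B * |f x|) ∂μ
  have iK : Integrable (fun x => |f x| ^ 3 + B * |f x| ^ 2 + B * |f x|) μ :=
    (hf3.add (if2.const_mul B)).add (if1a.const_mul B)
  have mu : ∀ t, Measurable (u t) := by intro t; simp only [u]; fun_prop
  -- one step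
  have step : ∀ t : ℝ, |t| ≤ 1 → ∀ n, ‖A t (n+1) - (1 - v * t ^ 2 / 2 : ℝ) * A t n‖
      ≤ (K + v * B) * |t| ^ 3 := by
    intro t ht n
    let R : Ω → ℂ := fun x => Complex.exp (Complex.I * ((t * f x : ℝ) : ℂ)) * u t x -
      (1 + Complex.I * t * ((f x + b x : ℝ) : ℂ)
        + t ^ 2 * ((c x - f x ^ 2 / 2 - f x * b x : ℝ) : ℂ))
    have mR : Measurable R := by
      have := mu t
      simp only [R]; fun_prop
    have bR : ∀ x, ‖R x‖ ≤ |t| ^ 3 * (|f x| ^ 3 + B * |f x| ^ 2 + B * |f x|) := fun x =>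
      remainder t (f x) (b x) (c x) B (hb x) (hc x)
    have iR : Integrable R μ := Integrable.mono' (iK.const_mul _) mR.aestronglyMeasurable
      (Eventually.of_forall bR)
    let G := E t n
    have mG : Measurable G := mE t n
    have mGT : Measurable (fun x => G (T x)) := mG.comp hT'
    have nG : ∀ x, ‖G x‖ ≤ 1 := nE' t n
    have nGT : ∀ x, ‖G (T x)‖ ≤ 1 := fun x => nG _
    have i0 : Integrable (fun x => G (T x)) μ := by
      simpa using int_bdd_mul (integrable_const (1:ℂ)) mGT nGT
    have i1 : Integrable (fun x => ((f x + b x : ℝ) : ℂ) * G (T x)) μ :=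
      int_bdd_mul (if1.add ib).ofReal mGT nGT
    have i2 : Integrable (fun x => ((c x - f x ^ 2 / 2 - f x * b x : ℝ) : ℂ) * G (T x)) μ :=
      int_bdd_mul ((ic.sub (if2'.div_const 2)).sub ifb).ofReal mGT nGT
    have i3 : Integrable (fun x => R x * G (T x)) μ := int_bdd_mul iR mGT nGT
    have e1 : A t (n+1) = ∫ x, G (T x) ∂μ + Complex.I * t * ∫ x, ((f x + b x : ℝ) : ℂ) * G (T x) ∂μ
        + t ^ 2 * ∫ x, ((c x - f x ^ 2 / 2 - f x * b x : ℝ) : ℂ) * G (T x) ∂μ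
        + ∫ x, R x * G (T x) ∂μ := by
      have k1 : Integrable (fun x => G (T x) + Complex.I * t * (((f x + b x : ℝ) : ℂ) * G (T x))) μ :=
        i0.add (i1.const_mul _)
      rw [← integral_const_mul, ← integral_const_mul, ← integral_add i0 (i1.const_mul _),
        ← integral_add k1 (i2.const_mul _), ← integral_add _ i3]
      · refine integral_congr_ae (Eventually.of_forall fun x => ?_)
        simp only [R, Esucc, G, Pi.add_apply]
        ring
      · exact k1.add (i2.const_mul _)
    have e0 : ∫ x, G (T x) ∂μ = ∫ x, G x ∂μ := by
      have := integral_map (μ := μ) hT'.aemeasurable (f := G) mG.aestronglyMeasurable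
      rw [hT.map_eq] at this
      exact this.symm
    rw [D1 G mG nG, D2 G mG nG, e0] at e1
    have j0 : Integrable G μ := by
      simpa using int_bdd_mul (integrable_const (1:ℂ)) mG nG
    have j1 : Integrable (fun x => (b x : ℂ) * G x) μ := int_bdd_mul ib.ofReal mG nG
    have j2 : Integrable (fun x => ((c x - v / 2 : ℝ) : ℂ) * G x) μ :=
      int_bdd_mul (ic.sub (integrable_const (v/2))).ofReal mG nG
    have j3 : Integrable (fun x => u t x * G x) μ := int_bdd_mul (iu t) mG nG
    have j2' : Integrable (fun x => (c x : ℂ) * G x) μ := int_bdd_mul ic.ofReal mG nG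
    have e2 : (∫ x, G x ∂μ) + Complex.I * t * ∫ x, (b x : ℂ) * G x ∂μ
        + t ^ 2 * ∫ x, ((c x - v / 2 : ℝ) : ℂ) * G x ∂μ
        = (1 - v * t ^ 2 / 2 : ℝ) * A t n
          + ∫ x, (v * t ^ 2 / 2 : ℝ) * (Complex.I * t * b x + t ^ 2 * c x) * G x ∂μ := by
      have k1 : Integrable (fun x => G x + Complex.I * t * ((b x : ℂ) * G x)) μ :=
        j0.add (j1.const_mul _)
      rw [← integral_const_mul, ← integral_const_mul, ← integral_add j0 (j1.const_mul _),
        ← integral_add k1 (j2.const_mul _), ← integral_const_mul,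
        ← integral_add (j3.const_mul _)]
      · refine integral_congr_ae (Eventually.of_forall fun x => ?_)
        simp only [u, G, Pi.add_apply]
        push_cast
        ring
      · refine int_bdd_mul ?_ mG nG
        exact ((ib.ofReal.const_mul _).add (ic.ofReal.const_mul _)).const_mul _
    rw [e2] at e1
    have e3 : A t (n+1) - (1 - v * t ^ 2 / 2 : ℝ) * A t n =
        ∫ x, (v * t ^ 2 / 2 : ℝ) * (Complex.I * t * b x + t ^ 2 * c x) * G x ∂μ
        + ∫ x, R x * G (T x) ∂μ := by rw [e1]; ring
    rw [e3]
    have b1 : ‖∫ x, (v * t ^ 2 / 2 : ℝ) * (Complex.I * t * b x + t ^ 2 * c x) * G x ∂μ‖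
        ≤ v * B * |t| ^ 3 := by
      have := norm_integral_le_of_norm_le_const (μ := μ) (C := v * B * |t| ^ 3)
        (f := fun x => (v * t ^ 2 / 2 : ℝ) * (Complex.I * t * b x + t ^ 2 * c x) * G x) ?_
      · simpa using this
      refine Eventually.of_forall fun x => ?_
      rw [norm_mul, norm_mul]
      have n1 : ‖Complex.I * t * b x + t ^ 2 * c x‖ ≤ |t| * B + |t| ^ 2 * B := by
        refine (norm_add_le _ _).trans ?_
        simp only [norm_mul, Complex.norm_I, one_mul, Complex.norm_real, Real.norm_eq_abs, norm_pow]
        gcongr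
        · exact hb x
        · exact hc x
      have n2 : ‖((v * t ^ 2 / 2 : ℝ) : ℂ)‖ = v * |t| ^ 2 / 2 := by
        rw [Complex.norm_real, Real.norm_eq_abs, abs_of_nonneg (by positivity), sq_abs]
      rw [n2]
      calc v * |t| ^ 2 / 2 * ‖Complex.I * t * b x + t ^ 2 * c x‖ * ‖G x‖
          ≤ v * |t| ^ 2 / 2 * (|t| * B + |t| ^ 2 * B) * 1 := by
            gcongr
            exact nG x
        _ = v * B * |t| ^ 3 * ((1 + |t|) / 2) := by ring
        _ ≤ v * B * |t| ^ 3 * 1 := by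
            gcongr
            linarith
        _ = _ := by ring
    have b2 : ‖∫ x, R x * G (T x) ∂μ‖ ≤ K * |t| ^ 3 := by
      have := norm_integral_le_of_norm_le (μ := μ) (iK.const_mul (|t| ^ 3))
        (f := fun x => R x * G (T x)) ?_
      · rw [integral_const_mul] at this
        linarith
      refine Eventually.of_forall fun x => ?_
      rw [norm_mul]
      calc ‖R x‖ * ‖G (T x)‖ ≤ ‖R x‖ * 1 := by gcongr; exact nGT x
        _ ≤ _ := by rw [mul_one]; exact bR x
    refine (norm_add_le _ _).trans ?_
    linarith
  -- iterate
  have iter : ∀ t : ℝ, |t| ≤ 1 → v * t ^ 2 ≤ 2 → ∀ n : ℕ,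
      ‖A t n - ((1 - v * t ^ 2 / 2 : ℝ) : ℂ) ^ n * A t 0‖ ≤ n * ((K + v * B) * |t| ^ 3) := by
    intro t ht hvt n
    induction n with
    | zero => simp
    | succ n ih =>
      have h1 := step t ht n
      have hl : ‖((1 - v * t ^ 2 / 2 : ℝ) : ℂ)‖ ≤ 1 := by
        rw [Complex.norm_real, Real.norm_eq_abs, abs_le]
        constructor <;> nlinarith [mul_nonneg hv (sq_nonneg t)]
      have e : A t (n+1) - ((1 - v * t ^ 2 / 2 : ℝ) : ℂ) ^ (n+1) * A t 0
          = (A t (n+1) - (1 - v * t ^ 2 / 2 : ℝ) * A t n) + ((1 - v * t ^ 2 / 2 : ℝ) : ℂ) *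
            (A t n - ((1 - v * t ^ 2 / 2 : ℝ) : ℂ) ^ n * A t 0) := by ring
      rw [e]
      refine (norm_add_le _ _).trans ?_
      rw [norm_mul]
      have : ‖((1 - v * t ^ 2 / 2 : ℝ) : ℂ)‖ * ‖A t n - ((1 - v * t ^ 2 / 2 : ℝ) : ℂ) ^ n * A t 0‖
        ≤ 1 * (n * ((K + v * B) * |t| ^ 3)) := by gcongr
      push_cast
      push_cast at this h1
      linarith
  -- comparison of A with the target
  have hu1 : ∀ t x, |t| ≤ 1 → ‖u t x - 1‖ ≤ 2 * B * |t| := by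
    intro t x ht
    have : u t x - 1 = Complex.I * t * b x + t ^ 2 * c x := by simp only [u]; ring
    rw [this]
    refine (norm_add_le _ _).trans ?_
    simp only [norm_mul, Complex.norm_I, one_mul, Complex.norm_real, Real.norm_eq_abs, norm_pow]
    have h1 := hb x
    have h2 := hc x
    have h3 : |t| ^ 2 ≤ |t| := by nlinarith [abs_nonneg t]
    calc |t| * |b x| + |t| ^ 2 * |c x| ≤ |t| * B + |t| * B := by gcongr
      _ = _ := by ring
  have comp1 : ∀ t n, |t| ≤ 1 → ‖∫ x, E t n x ∂μ - A t n‖ ≤ 2 * B * |t| := by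
    intro t n ht
    have j0 : Integrable (E t n) μ := by
      simpa using int_bdd_mul (integrable_const (1:ℂ)) (mE t n) (nE' t n)
    rw [← integral_sub j0 (int_bdd_mul (iu t) (mE t n) (nE' t n))]
    have := norm_integral_le_of_norm_le_const (μ := μ) (C := 2 * B * |t|)
        (f := fun x => E t n x - u t x * E t n x) ?_
    · simpa using this
    refine Eventually.of_forall fun x => ?_
    rw [show E t n x - u t x * E t n x = -(u t x - 1) * E t n x by ring, norm_mul, nE, norm_neg,
      mul_one]
    exact hu1 t x ht
  have compρ : ∀ t n, ‖∫ x, (ρ x : ℂ) * E t n x ∂μ - ∫ x, E t n x ∂μ‖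
      ≤ B * (2 * (∫ x, |f x| ∂μ)) * |t| := by
    intro t n
    have j0 : Integrable (E t n) μ := by
      simpa using int_bdd_mul (integrable_const (1:ℂ)) (mE t n) (nE' t n)
    have mET : Measurable (fun x => E t n (T x)) := (mE t n).comp hT'
    have k1 : Integrable (fun x => (ρ x : ℂ) * E t n x) μ := int_bdd_mul hρ.ofReal (mE t n) (nE' t n)
    have k2 : Integrable (fun x => (d x : ℂ) * E t n x) μ := int_bdd_mul id.ofReal (mE t n) (nE' t n)
    have k3 : Integrable (fun x => (d x : ℂ) * E t n (T x)) μ :=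
      int_bdd_mul id.ofReal mET (fun x => nE' t n _)
    rw [← integral_sub k1 j0]
    have e := D3 (E t n) (mE t n) (nE' t n)
    rw [← integral_sub k2 k3] at e
    have e' : ∫ x, ((ρ x : ℂ) * E t n x - E t n x) ∂μ = ∫ x, ((ρ x - 1 : ℝ) : ℂ) * E t n x ∂μ := by
      refine integral_congr_ae (Eventually.of_forall fun x => ?_)
      push_cast; ring
    rw [e', e]
    have hTn := hT.iterate n
    have ifn : Integrable (fun x => |f (T^[n] x)|) μ := by
      exact hTn.integrable_comp_of_integrable if1a
    have efn : ∫ x, |f (T^[n] x)| ∂μ = ∫ x, |f x| ∂μ := by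
      have := integral_map (μ := μ) hTn.measurable.aemeasurable (f := fun x => |f x|)
        (by fun_prop)
      rw [hTn.map_eq] at this
      exact this.symm
    have := norm_integral_le_of_norm_le (μ := μ) ((if1a.add ifn).const_mul (B * |t|))
        (f := fun x => (d x : ℂ) * E t n x - (d x : ℂ) * E t n (T x)) ?_
    · rw [integral_const_mul, integral_add' if1a ifn, efn] at this
      linarith
    refine Eventually.of_forall fun x => ?_
    rw [← mul_sub, norm_mul, mul_assoc]
    have n1 : ‖((d x : ℝ) : ℂ)‖ ≤ B := by
      rw [Complex.norm_real]; exact hd x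
    have key : E t n x - E t n (T x) =
        E t n (T x) * (Complex.exp (Complex.I * ((t * (f x - f (T^[n] x)) : ℝ) : ℂ)) - 1) := by
      rw [mul_sub, mul_one]
      congr 1
      simp only [E, S]
      rw [← Complex.exp_add, ← mul_add, ← Complex.ofReal_add]
      congr 3
      have h1 := birkhoffSum_succ T f n x
      have h2 := birkhoffSum_succ' T f n x
      rw [h1] at h2
      rw [← mul_add]
      congr 1
      linarith
    have n2 : ‖E t n x - E t n (T x)‖ ≤ |t| * (|f x| + |f (T^[n] x)|) := by
      rw [key, norm_mul, nE, one_mul]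
      refine (exp1 _).trans ?_
      rw [abs_mul]
      gcongr
      exact abs_sub _ _
    simp only [Pi.add_apply]
    gcongr
  -- the limit
  let tn : ℕ → ℝ := fun n => s / Real.sqrt n
  have htn : Tendsto tn atTop (nhds 0) :=
    tendsto_const_nhds.div_atTop (Real.tendsto_sqrt_atTop.comp tendsto_natCast_atTop_atTop)
  have htn' : Tendsto (fun n => |tn n|) atTop (nhds 0) := by simpa using htn.abs
  have ev1 : ∀ᶠ n in atTop, |tn n| ≤ 1 :=
    (htn'.eventually (gt_mem_nhds (show (0:ℝ) < 1 by norm_num))).mono fun n h => h.le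
  have ev2 : ∀ᶠ n in atTop, v * tn n ^ 2 ≤ 2 := by
    have : Tendsto (fun n => v * tn n ^ 2) atTop (nhds 0) := by
      simpa using (htn.pow 2).const_mul v
    exact (this.eventually (gt_mem_nhds (show (0:ℝ) < 2 by norm_num))).mono fun n h => h.le
  have hsq : ∀ᶠ n : ℕ in atTop, (n : ℝ) * tn n ^ 2 = s ^ 2 := by
    filter_upwards [eventually_gt_atTop 0] with n hn
    have : (0:ℝ) < n := by exact_mod_cast hn
    simp only [tn]
    rw [div_pow, Real.sq_sqrt this.le]
    field_simp
  have lim1 : Tendsto (fun n : ℕ => ((1 - v * tn n ^ 2 / 2 : ℝ) : ℂ) ^ n) atTop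
      (nhds (Complex.exp (-(v * s ^ 2 / 2 : ℝ)))) := by
    have : Tendsto (fun n : ℕ => (1 + (-(v * tn n ^ 2 / 2))) ^ n) atTop
        (nhds (Real.exp (-(v * s ^ 2 / 2)))) := by
      refine Real.tendsto_one_add_pow_exp_of_tendsto ?_
      refine tendsto_const_nhds.congr' ?_
      filter_upwards [hsq] with n hn
      rw [← hn]; ring
    have h2 := (Complex.continuous_ofReal.tendsto _).comp this
    rw [← Complex.ofReal_neg, ← Complex.ofReal_exp]
    refine h2.congr fun n => ?_
    simp [sub_eq_add_neg]
  have lim0 : Tendsto (fun n : ℕ => A (tn n) 0) atTop (nhds 1) := by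
    rw [tendsto_iff_norm_sub_tendsto_zero]
    refine squeeze_zero' (Eventually.of_forall fun n => norm_nonneg _)
      (g := fun n => 2 * B * |tn n|) ?_ (by simpa using htn'.const_mul (2 * B))
    filter_upwards [ev1] with n hn
    have := comp1 (tn n) 0 hn
    rw [norm_sub_rev] at this
    simpa [E, S] using this
  have limE : Tendsto (fun n : ℕ => (n:ℝ) * ((K + v * B) * |tn n| ^ 3)) atTop (nhds 0) := by
    have : Tendsto (fun n : ℕ => (K + v * B) * s ^ 2 * |tn n|) atTop (nhds 0) := by
      simpa using htn'.const_mul ((K + v * B) * s ^ 2)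
    refine this.congr' ?_
    filter_upwards [hsq] with n hn
    rw [← hn, ← sq_abs (tn n)]; ring
  have limA : Tendsto (fun n : ℕ => A (tn n) n) atTop (nhds (Complex.exp (-(v * s ^ 2 / 2 : ℝ)))) := by
    have h1 := lim1.mul lim0
    rw [mul_one] at h1
    have h2 : Tendsto (fun n : ℕ => A (tn n) n -
        ((1 - v * tn n ^ 2 / 2 : ℝ) : ℂ) ^ n * A (tn n) 0) atTop (nhds 0) := by
      rw [tendsto_zero_iff_norm_tendsto_zero]
      refine squeeze_zero' (Eventually.of_forall fun n => norm_nonneg _) ?_ limE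
      filter_upwards [ev1, ev2] with n h1 h2
      exact iter _ h1 h2 n
    simpa using h2.add h1
  have limB : Tendsto (fun n : ℕ => (∫ x, (ρ x : ℂ) * E (tn n) n x ∂μ) - A (tn n) n) atTop
      (nhds 0) := by
    rw [tendsto_zero_iff_norm_tendsto_zero]
    refine squeeze_zero' (Eventually.of_forall fun n => norm_nonneg _)
      (g := fun n => (B * (2 * (∫ x, |f x| ∂μ)) + 2 * B) * |tn n|) ?_
      (by simpa using htn'.const_mul (B * (2 * (∫ x, |f x| ∂μ)) + 2 * B))
    filter_upwards [ev1] with n hn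
    have h1 := compρ (tn n) n
    have h2 := comp1 (tn n) n hn
    refine (norm_sub_le_norm_sub_add_norm_sub _ (∫ x, E (tn n) n x ∂μ) _).trans ?_
    linarith
  have := limB.add limA
  simp only [sub_add_cancel, zero_add] at this
  exact this

end KnCLT


namespace KnCLT

/-- clamp to the unit interval -/
noncomputable def cl (x : ℝ) : ℝ := max 0 (min 1 x)

lemma cl_nonneg (x : ℝ) : 0 ≤ cl x := le_max_left _ _
lemma cl_le (x : ℝ) : cl x ≤ 1 := max_le zero_le_one (min_le_left _ _)
lemma cl_of_mem {x : ℝ} (h0 : 0 ≤ x) (h1 : x ≤ 1) : cl x = x := by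
  unfold cl; rw [min_eq_right h1, max_eq_right h0]
lemma cl_lip (x y : ℝ) : |cl x - cl y| ≤ |x - y| := by
  unfold cl
  rw [max_comm 0, max_comm 0]
  refine (abs_max_sub_max_le_abs _ _ _).trans ?_
  rw [min_comm 1, min_comm 1]
  exact abs_min_sub_min_le_max _ _ _ _ |>.trans (by simp)
lemma cl_cont : Continuous cl := by unfold cl; fun_prop

noncomputable def pk (k : ℕ) (x : ℝ) : ℝ := (1 + x) / ((k + 1 + x) * (k + 2 + x))
noncomputable def uk (k : ℕ) (x : ℝ) : ℝ := 1 / (k + 1 + x)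
/-- Gauss transfer operator -/
noncomputable def gL (ψ : ℝ → ℝ) (x : ℝ) : ℝ := ∑' k : ℕ, pk k (cl x) * ψ (uk k (cl x))

lemma pk_nonneg (k : ℕ) {x : ℝ} (hx : 0 ≤ x) : 0 ≤ pk k x := by unfold pk; positivity

lemma pk_eq (k : ℕ) {x : ℝ} (hx : 0 ≤ x) :
    pk k x = (1 + x) / (k + 1 + x) - (1 + x) / ((k + 1 : ℕ) + 1 + x) := by
  unfold pk
  have h1 : (k:ℝ) + 1 + x ≠ 0 := by positivity
  have h2 : (k:ℝ) + 2 + x ≠ 0 := by positivity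
  have h3 : (k:ℝ) + 1 + 1 + x ≠ 0 := by positivity
  push_cast
  field_simp
  ring

lemma pk_sum (N : ℕ) {x : ℝ} (hx : 0 ≤ x) :
    ∑ k ∈ Finset.range N, pk k x = 1 - (1 + x) / (N + 1 + x) := by
  rw [Finset.sum_congr rfl (fun k _ => pk_eq k hx),
    Finset.sum_range_sub' (fun k : ℕ => (1 + x) / ((k:ℝ) + 1 + x))]
  congr 1
  have : (1:ℝ) + x ≠ 0 := by positivity
  simp [this]

lemma tail_tendsto (x : ℝ) : Tendsto (fun N : ℕ => (1 + x) / ((N:ℝ) + 1 + x)) atTop (nhds 0) := by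
  refine tendsto_const_nhds.div_atTop ?_
  exact tendsto_atTop_add_const_right _ _ (tendsto_atTop_add_const_right _ _
    tendsto_natCast_atTop_atTop)

lemma pk_hasSum {x : ℝ} (hx : 0 ≤ x) : HasSum (fun k => pk k x) 1 := by
  rw [hasSum_iff_tendsto_nat_of_nonneg (fun k => pk_nonneg k hx)]
  simp_rw [pk_sum _ hx]
  simpa using (tail_tendsto x).const_sub 1

lemma uk_mem (k : ℕ) {x : ℝ} (hx : 0 ≤ x) : 0 ≤ uk k x ∧ uk k x ≤ 1 := by
  unfold uk
  refine ⟨by positivity, ?_⟩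
  rw [div_le_one (by positivity)]
  have : (0:ℝ) ≤ k := by positivity
  linarith

lemma uk_diff (k : ℕ) {x y : ℝ} (hx : 0 ≤ x) (hy : 0 ≤ y) :
    |uk k x - uk k y| = |x - y| / ((k + 1 + x) * (k + 1 + y)) := by
  unfold uk
  rw [div_sub_div _ _ (by positivity) (by positivity), abs_div,
    abs_of_pos (show 0 < ((k:ℝ) + 1 + x) * (k + 1 + y) by positivity), abs_sub_comm x y]
  congr 2
  ring

lemma gL_const (c x : ℝ) : gL (fun _ => c) x = c := by
  unfold gL
  have := (pk_hasSum (cl_nonneg x)).mul_right c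
  simpa using this.tsum_eq

/-- Lipschitz on the unit interval -/
def LipI (K : ℝ) (ψ : ℝ → ℝ) : Prop :=
  ∀ x y, 0 ≤ x → x ≤ 1 → 0 ≤ y → y ≤ 1 → |ψ x - ψ y| ≤ K * |x - y|

lemma LipI.bdd {K : ℝ} {ψ : ℝ → ℝ} (h : LipI K ψ) {x : ℝ} (h0 : 0 ≤ x) (h1 : x ≤ 1) :
    |ψ x| ≤ |ψ 0| + K := by
  have h2 := h x 0 h0 h1 le_rfl zero_le_one
  have h3 := h 1 0 zero_le_one le_rfl le_rfl zero_le_one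
  have hK : 0 ≤ K := by simpa using (abs_nonneg _).trans h3
  have h4 : |x - 0| ≤ 1 := by rw [sub_zero, abs_of_nonneg h0]; exact h1
  have h5 : |ψ x| ≤ |ψ x - ψ 0| + |ψ 0| := by
    have := abs_add_le (ψ x - ψ 0) (ψ 0)
    simpa using this
  nlinarith

lemma LipI.nonneg {K : ℝ} {ψ : ℝ → ℝ} (h : LipI K ψ) : 0 ≤ K := by
  have h3 := h 1 0 zero_le_one le_rfl le_rfl zero_le_one
  simpa using (abs_nonneg _).trans h3

lemma gL_summable {K : ℝ} {ψ : ℝ → ℝ} (h : LipI K ψ) {x : ℝ} (hx : 0 ≤ x) :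
    Summable (fun k : ℕ => pk k x * ψ (uk k x)) := by
  refine Summable.of_norm_bounded ((pk_hasSum hx).summable.mul_right (|ψ 0| + K)) fun k => ?_
  rw [norm_mul, Real.norm_eq_abs, abs_of_nonneg (pk_nonneg k hx)]
  exact mul_le_mul_of_nonneg_left (h.bdd (uk_mem k hx).1 (uk_mem k hx).2) (pk_nonneg k hx)

lemma cube_sum (N : ℕ) :
    ∑ k ∈ Finset.range N, 1 / ((k:ℝ) + 2) ^ 3 ≤ 5 / 24 := by
  have key : ∀ N : ℕ, ∑ k ∈ Finset.range (N+1), 1 / ((k:ℝ) + 2) ^ 3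
      ≤ 5 / 24 - 1 / 2 / (((N:ℝ) + 2) * ((N:ℝ) + 3)) := by
    intro N
    induction N with
    | zero => norm_num
    | succ N ih =>
      rw [Finset.sum_range_succ]
      have : 1 / (((N+1:ℕ):ℝ) + 2) ^ 3 ≤ 1 / 2 / (((N:ℝ) + 2) * (N + 3))
          - 1 / 2 / ((((N+1:ℕ):ℝ) + 2) * ((N+1:ℕ) + 3)) := by
        push_cast
        have e : 1 / 2 / (((N:ℝ) + 2) * (N + 3)) - 1 / 2 / (((N:ℝ) + 1 + 2) * (N + 1 + 3))
          = 1 / (((N:ℝ) + 2) * (N + 3) * (N + 4)) := by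
          have h1 : (N:ℝ) + 2 ≠ 0 := by positivity
          have h2 : (N:ℝ) + 3 ≠ 0 := by positivity
          have h3 : (N:ℝ) + 4 ≠ 0 := by positivity
          rw [show (N:ℝ) + 1 + 2 = N + 3 by ring, show (N:ℝ) + 1 + 3 = N + 4 by ring]
          field_simp
          ring
        rw [e]
        apply one_div_le_one_div_of_le (by positivity)
        have : (0:ℝ) ≤ N := by positivity
        nlinarith
      linarith
  cases N with
  | zero => norm_num
  | succ N =>
    refine (key N).trans ?_
    have : 0 ≤ 1 / 2 / (((N:ℝ) + 2) * (N + 3)) := by positivity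
    linarith

lemma abel (D ψ : ℕ → ℝ) (h0 : D 0 = 0) (N : ℕ) :
    ∑ k ∈ Finset.range (N+1), (D k - D (k+1)) * ψ k
      = ∑ k ∈ Finset.range N, D (k+1) * (ψ (k+1) - ψ k) - D (N+1) * ψ N := by
  induction N with
  | zero => simp [h0]
  | succ N ih =>
    rw [Finset.sum_range_succ, ih, Finset.sum_range_succ]
    ring

lemma gL_contract_aux {K : ℝ} {ψ : ℝ → ℝ} (h : LipI K ψ) {x y : ℝ} (hx : 0 ≤ x) (hx1 : x ≤ 1)
    (hy : 0 ≤ y) (hy1 : y ≤ 1) :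
    |(∑' k : ℕ, pk k x * ψ (uk k x)) - ∑' k : ℕ, pk k y * ψ (uk k y)| ≤ (5 / 6 * K) * |x - y| := by
  have hK := h.nonneg
  have hs1 := (gL_summable h hx).hasSum.tendsto_sum_nat
  have hs2 := (gL_summable h hy).hasSum.tendsto_sum_nat
  let D : ℕ → ℝ := fun k => (1 + x) / ((k:ℝ) + 1 + x) - (1 + y) / ((k:ℝ) + 1 + y)
  have hD0 : D 0 = 0 := by
    simp only [D]
    have : (1:ℝ) + x ≠ 0 := by positivity
    have : (1:ℝ) + y ≠ 0 := by positivity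
    simp [*]
  have hDt : Tendsto D atTop (nhds 0) := by
    simpa using (tail_tendsto x).sub (tail_tendsto y)
  have hl := ((hs1.sub hs2).abs).comp (tendsto_add_atTop_nat 1)
  have hr : Tendsto (fun N : ℕ => (5 / 6 * K) * |x - y| + |D (N+1)| * (|ψ 0| + K)) atTop
      (nhds ((5 / 6 * K) * |x - y|)) := by
    have := ((hDt.comp (tendsto_add_atTop_nat 1)).abs.mul_const (|ψ 0| + K)).const_add
      ((5 / 6 * K) * |x - y|)
    simpa using this
  refine le_of_tendsto_of_tendsto' hl hr fun N => ?_
  simp only [Function.comp]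
  have e : ∑ k ∈ Finset.range (N+1), pk k x * ψ (uk k x) - ∑ k ∈ Finset.range (N+1), pk k y * ψ (uk k y)
      = ∑ k ∈ Finset.range (N+1), pk k y * (ψ (uk k x) - ψ (uk k y))
        + ∑ k ∈ Finset.range (N+1), (D k - D (k+1)) * ψ (uk k x) := by
    rw [← Finset.sum_sub_distrib, ← Finset.sum_add_distrib]
    refine Finset.sum_congr rfl fun k _ => ?_
    have : D k - D (k+1) = pk k x - pk k y := by
      rw [pk_eq k hx, pk_eq k hy]; simp only [D]; ring
    rw [this]; ring
  rw [e, abel D (fun k => ψ (uk k x)) hD0]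
  have b1 : |∑ k ∈ Finset.range (N+1), pk k y * (ψ (uk k x) - ψ (uk k y))| ≤ 5 / 8 * K * |x - y| := by
    refine (Finset.abs_sum_le_sum_abs _ _).trans ?_
    have t : ∀ k : ℕ, |pk k y * (ψ (uk k x) - ψ (uk k y))|
        ≤ K * |x - y| * (pk k y * (if k = 0 then 1 else 1 / 4)) := by
      intro k
      rw [abs_mul, abs_of_nonneg (pk_nonneg k hy)]
      have h1 := h (uk k x) (uk k y) (uk_mem k hx).1 (uk_mem k hx).2 (uk_mem k hy).1 (uk_mem k hy).2
      rw [uk_diff k hx hy] at h1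
      have h2 : |x - y| / (((k:ℝ) + 1 + x) * (k + 1 + y)) ≤ |x - y| * (if k = 0 then 1 else 1 / 4) := by
        rw [div_eq_mul_inv]
        refine mul_le_mul_of_nonneg_left ?_ (abs_nonneg _)
        split_ifs with hk
        · subst hk
          apply inv_le_one_of_one_le₀
          push_cast
          nlinarith
        · have : (1:ℝ) ≤ k := by exact_mod_cast Nat.one_le_iff_ne_zero.2 hk
          rw [one_div]
          apply inv_anti₀ (by norm_num)
          nlinarith
      calc pk k y * |ψ (uk k x) - ψ (uk k y)| ≤ pk k y * (K * (|x - y| * (if k = 0 then 1 else 1 / 4))) := by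
            refine mul_le_mul_of_nonneg_left (h1.trans ?_) (pk_nonneg k hy)
            exact mul_le_mul_of_nonneg_left h2 hK
        _ = _ := by ring
    refine (Finset.sum_le_sum fun k _ => t k).trans ?_
    rw [← Finset.mul_sum]
    have s1 : ∑ k ∈ Finset.range (N+1), pk k y * (if k = 0 then (1:ℝ) else 1 / 4) ≤ 5 / 8 := by
      have e : ∀ k, pk k y * (if k = 0 then (1:ℝ) else 1 / 4) =
          pk k y * (1/4) + (if k = 0 then pk k y * (3/4) else 0) := by
        intro k; split_ifs <;> ring
      rw [Finset.sum_congr rfl fun k _ => e k, Finset.sum_add_distrib, ← Finset.sum_mul, pk_sum _ hy,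
        Finset.sum_ite_eq' (Finset.range (N+1)) 0 (fun k => pk k y * (3/4))]
      have p0 : pk 0 y ≤ 1 / 2 := by
        unfold pk
        push_cast
        rw [div_le_div_iff₀ (by positivity) (by norm_num)]
        nlinarith
      have q : 0 ≤ (1 + y) / (((N+1:ℕ):ℝ) + 1 + y) := by positivity
      simp only [Finset.mem_range, Nat.succ_pos', if_true]
      linarith
    have : 0 ≤ K * |x - y| := by positivity
    nlinarith
  have b2 : |∑ k ∈ Finset.range N, D (k+1) * (ψ (uk (k+1) x) - ψ (uk k x))|
      ≤ 5 / 24 * K * |x - y| := by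
    refine (Finset.abs_sum_le_sum_abs _ _).trans ?_
    have t : ∀ k : ℕ, |D (k+1) * (ψ (uk (k+1) x) - ψ (uk k x))|
        ≤ K * |x - y| * (1 / ((k:ℝ) + 2) ^ 3) := by
      intro k
      rw [abs_mul]
      have h1 := h (uk (k+1) x) (uk k x) (uk_mem _ hx).1 (uk_mem _ hx).2 (uk_mem _ hx).1 (uk_mem _ hx).2
      have h2 : |uk (k+1) x - uk k x| = 1 / (((k:ℝ) + 2 + x) * (k + 1 + x)) := by
        have e : uk (k+1) x - uk k x = - (1 / (((k:ℝ) + 2 + x) * (k + 1 + x))) := by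
          unfold uk
          push_cast
          have h1 : (k:ℝ) + 1 + x ≠ 0 := by positivity
          have h2 : (k:ℝ) + 2 + x ≠ 0 := by positivity
          rw [show (k:ℝ) + 1 + 1 + x = k + 2 + x by ring]
          field_simp
          ring
        rw [e, abs_neg, abs_of_nonneg (by positivity)]
      have h3 : |D (k+1)| = |x - y| * ((k + 1) / ((k + 2 + x) * (k + 2 + y))) := by
        have e : D (k+1) = (x - y) * ((k + 1) / ((k + 2 + x) * (k + 2 + y))) := by
          simp only [D]
          push_cast
          have h1 : (k:ℝ) + 2 + y ≠ 0 := by positivity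
          have h2 : (k:ℝ) + 2 + x ≠ 0 := by positivity
          rw [show (k:ℝ) + 1 + 1 + x = k + 2 + x by ring, show (k:ℝ) + 1 + 1 + y = k + 2 + y by ring]
          field_simp
          ring
        rw [e, abs_mul, abs_of_nonneg (show 0 ≤ ((k:ℝ) + 1) / ((k + 2 + x) * (k + 2 + y)) by positivity)]
      rw [h3]
      rw [h2] at h1
      have h4 : ((k:ℝ) + 1) / ((k + 2 + x) * (k + 2 + y)) * (1 / (((k:ℝ) + 2 + x) * (k + 1 + x)))
          ≤ 1 / ((k:ℝ) + 2) ^ 3 := by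
        rw [div_mul_div_comm, mul_one]
        rw [div_le_div_iff₀ (by positivity) (by positivity), one_mul]
        have : ((k:ℝ) + 1) * (k + 2) ^ 3 = ((k + 2) * (k + 2)) * ((k + 2) * (k + 1)) := by ring
        rw [this]
        have a1 : (k:ℝ) + 2 ≤ k + 2 + x := by linarith
        have a2 : (k:ℝ) + 2 ≤ k + 2 + y := by linarith
        have a3 : (k:ℝ) + 1 ≤ k + 1 + x := by linarith
        exact mul_le_mul (mul_le_mul a1 a2 (by positivity) (by positivity))
          (mul_le_mul a1 a3 (by positivity) (by positivity)) (by positivity) (by positivity)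
      calc |x - y| * (((k:ℝ) + 1) / ((k + 2 + x) * (k + 2 + y))) * |ψ (uk (k+1) x) - ψ (uk k x)|
          ≤ |x - y| * (((k:ℝ) + 1) / ((k + 2 + x) * (k + 2 + y))) *
            (K * (1 / (((k:ℝ) + 2 + x) * (k + 1 + x)))) := by gcongr
        _ = K * |x - y| * (((k:ℝ) + 1) / ((k + 2 + x) * (k + 2 + y)) *
            (1 / (((k:ℝ) + 2 + x) * (k + 1 + x)))) := by ring
        _ ≤ _ := by gcongr
    refine (Finset.sum_le_sum fun k _ => t k).trans ?_
    rw [← Finset.mul_sum]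
    have := cube_sum N
    have h0 : 0 ≤ K * |x - y| := by positivity
    nlinarith
  have b3 : |D (N+1) * ψ (uk N x)| ≤ |D (N+1)| * (|ψ 0| + K) := by
    rw [abs_mul]
    exact mul_le_mul_of_nonneg_left (h.bdd (uk_mem _ hx).1 (uk_mem _ hx).2) (abs_nonneg _)
  have t1 := abs_add_le (∑ k ∈ Finset.range (N+1), pk k y * (ψ (uk k x) - ψ (uk k y)))
    (∑ k ∈ Finset.range N, D (k+1) * (ψ (uk (k+1) x) - ψ (uk k x)) - D (N+1) * ψ (uk N x))
  have t2 := abs_sub (∑ k ∈ Finset.range N, D (k+1) * (ψ (uk (k+1) x) - ψ (uk k x)))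
    (D (N+1) * ψ (uk N x))
  linarith

lemma gL_contract {K : ℝ} {ψ : ℝ → ℝ} (h : LipI K ψ) (x y : ℝ) :
    |gL ψ x - gL ψ y| ≤ (5 / 6 * K) * |x - y| := by
  unfold gL
  refine (gL_contract_aux h (cl_nonneg x) (cl_le x) (cl_nonneg y) (cl_le y)).trans ?_
  have := h.nonneg
  exact mul_le_mul_of_nonneg_left (cl_lip x y) (by linarith)

lemma gL_cl (ψ : ℝ → ℝ) (x : ℝ) : gL ψ (cl x) = gL ψ x := by
  unfold gL; rw [cl_of_mem (cl_nonneg x) (cl_le x)]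

/-- functions with moderate singularity at 0 -/
def Good (C : ℝ) (F : ℝ → ℝ) : Prop :=
  ∀ k : ℕ, ∀ x y, 0 ≤ x → x ≤ 1 → 0 ≤ y → y ≤ 1 →
    |F (uk k x)| ≤ C * Real.sqrt (k + 1) ∧ |F (uk k x) - F (uk k y)| ≤ C * |x - y|

noncomputable def wk (k : ℕ) : ℝ := Real.sqrt (k + 1) / ((k + 1) * (k + 2))

lemma wk_nonneg (k : ℕ) : 0 ≤ wk k := by unfold wk; positivity

lemma wk_summable : Summable wk := by
  have h := (summable_nat_add_iff 1).2
    (Real.summable_one_div_nat_rpow (p := 3/2)|>.2 (by norm_num))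
  refine Summable.of_nonneg_of_le wk_nonneg (fun k => ?_) h
  unfold wk
  push_cast
  have hk : (0:ℝ) < (k:ℝ) + 1 := by positivity
  rw [show (3/2 : ℝ) = 2 - 1/2 by norm_num, Real.rpow_sub hk, ← Real.sqrt_eq_rpow, Real.rpow_two,
    one_div_div]
  apply div_le_div_of_nonneg_left (Real.sqrt_nonneg _) (by positivity)
  nlinarith

lemma pk_diff (k : ℕ) {x y : ℝ} (hx : 0 ≤ x) (hy : 0 ≤ y) :
    |pk k x - pk k y| ≤ |x - y| * (1 / ((k + 1) * (k + 2))) := by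
  have e : pk k x - pk k y = (x - y) * ((k * (k + 1) - (1 + x) * (1 + y)) /
      (((k + 1 + x) * (k + 2 + x)) * ((k + 1 + y) * (k + 2 + y)))) := by
    unfold pk
    have h1 : (k:ℝ) + 1 + x ≠ 0 := by positivity
    have h2 : (k:ℝ) + 2 + x ≠ 0 := by positivity
    have h3 : (k:ℝ) + 1 + y ≠ 0 := by positivity
    have h4 : (k:ℝ) + 2 + y ≠ 0 := by positivity
    field_simp
    ring
  rw [e, abs_mul, abs_div, abs_of_pos (show 0 < ((k + 1 + x) * (k + 2 + x)) * (((k:ℝ) + 1 + y) * (k + 2 + y)) by positivity)]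
  refine mul_le_mul_of_nonneg_left ?_ (abs_nonneg _)
  have hk : (0:ℝ) ≤ k := by positivity
  have h1 : |k * (k + 1) - (1 + x) * (1 + y)| ≤ ((k:ℝ) + 1 + x) * (k + 2 + y) := by
    have : |(k:ℝ) * (k + 1) - (1 + x) * (1 + y)| ≤ k * (k + 1) + (1 + x) * (1 + y) := by
      rw [abs_le]
      constructor <;> nlinarith [mul_nonneg hx hy, mul_nonneg hk hk]
    refine this.trans ?_
    nlinarith [mul_nonneg hx hy, mul_nonneg hk hk, mul_nonneg hk hx, mul_nonneg hk hy]
  rw [div_le_div_iff₀ (by positivity) (by positivity), one_mul]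
  calc |k * (k + 1) - (1 + x) * (1 + y)| * (((k:ℝ) + 1) * (k + 2))
      ≤ (((k:ℝ) + 1 + x) * (k + 2 + y)) * (((k:ℝ) + 1 + y) * (k + 2 + x)) := by
        have a2 : (k:ℝ) + 1 ≤ k + 1 + y := by linarith
        have a3 : (k:ℝ) + 2 ≤ k + 2 + x := by linarith
        exact mul_le_mul h1
          (mul_le_mul a2 a3 (by positivity) (by positivity)) (by positivity) (by positivity)
    _ = _ := by ring

lemma pk_le (k : ℕ) {x : ℝ} (hx : 0 ≤ x) (hx1 : x ≤ 1) : pk k x ≤ 2 * (1 / ((k + 1) * (k + 2))) := by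
  unfold pk
  rw [mul_one_div]
  have a2 : (k:ℝ) + 1 ≤ k + 1 + x := by linarith
  have a3 : (k:ℝ) + 2 ≤ k + 2 + x := by linarith
  exact div_le_div₀ (by norm_num) (by linarith) (by positivity)
    (mul_le_mul a2 a3 (by positivity) (by positivity))

lemma good_summable {C : ℝ} {F : ℝ → ℝ} (h : Good C F) {x : ℝ} (hx : 0 ≤ x) (hx1 : x ≤ 1) :
    Summable (fun k : ℕ => pk k x * F (uk k x)) := by
  refine Summable.of_norm_bounded (wk_summable.mul_left (2 * C)) fun k => ?_
  rw [norm_mul, Real.norm_eq_abs, abs_of_nonneg (pk_nonneg k hx)]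
  calc pk k x * ‖F (uk k x)‖ ≤ (2 * (1 / ((k + 1) * (k + 2)))) * (C * Real.sqrt (k + 1)) := by
        have := pk_nonneg k hx
        exact mul_le_mul (pk_le k hx hx1) (h k x x hx hx1 hx hx1).1 (norm_nonneg _) (by positivity)
    _ = _ := by unfold wk; ring

lemma good_lip {C : ℝ} {F : ℝ → ℝ} (h : Good C F) :
    ∃ K, LipI K (gL F) := by
  have hC : 0 ≤ C := by
    have := (h 0 0 0 le_rfl zero_le_one le_rfl zero_le_one).1
    simpa using (abs_nonneg _).trans this
  refine ⟨C + C * ∑' k, wk k, fun x y hx hx1 hy hy1 => ?_⟩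
  unfold gL
  rw [cl_of_mem hx hx1, cl_of_mem hy hy1]
  rw [← (good_summable h hx hx1).tsum_sub (good_summable h hy hy1)]
  have hs : Summable (fun k : ℕ => |x - y| * (C * pk k y + C * wk k)) :=
    (((pk_hasSum hy).summable.mul_left C).add (wk_summable.mul_left C)).mul_left _
  have hb : ∀ k : ℕ, ‖pk k x * F (uk k x) - pk k y * F (uk k y)‖ ≤ |x - y| * (C * pk k y + C * wk k) := by
    intro k
    have e : pk k x * F (uk k x) - pk k y * F (uk k y) =
      pk k y * (F (uk k x) - F (uk k y)) + (pk k x - pk k y) * F (uk k x) := by ring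
    rw [e]
    refine (norm_add_le _ _).trans ?_
    rw [norm_mul, norm_mul, Real.norm_eq_abs, Real.norm_eq_abs, Real.norm_eq_abs, Real.norm_eq_abs,
      abs_of_nonneg (pk_nonneg k hy)]
    have h1 := (h k x y hx hx1 hy hy1).2
    have h2 := (h k x y hx hx1 hy hy1).1
    have h3 := pk_diff k hx hy
    calc pk k y * |F (uk k x) - F (uk k y)| + |pk k x - pk k y| * |F (uk k x)|
        ≤ pk k y * (C * |x - y|) + (|x - y| * (1 / ((k + 1) * (k + 2)))) * (C * Real.sqrt (k + 1)) := by
          have := pk_nonneg k hy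
          gcongr
      _ = _ := by unfold wk; ring
  have := tsum_of_norm_bounded hs.hasSum hb
  rw [Real.norm_eq_abs, tsum_mul_left, ((pk_hasSum hy).summable.mul_left C).tsum_add
    (wk_summable.mul_left C), tsum_mul_left, tsum_mul_left, (pk_hasSum hy).tsum_eq] at this
  linarith

end KnCLT


namespace KnCLT

lemma uk_floor (k : ℕ) {t : ℝ} (ht : t ∈ Ico (0:ℝ) 1) : ⌊1 / uk k t⌋ = (k:ℤ) + 1 := by
  unfold uk
  rw [one_div_one_div, Int.floor_eq_iff]
  push_cast
  exact ⟨by linarith [ht.1], by linarith [ht.2]⟩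

lemma uk_pos (k : ℕ) {t : ℝ} (ht : 0 ≤ t) : 0 < uk k t := by
  unfold uk; positivity

lemma uk_inv (k : ℕ) (t : ℝ) : 1 / uk k t = k + 1 + t := by
  unfold uk; rw [one_div_one_div]

lemma gauss_uk (k : ℕ) {t : ℝ} (ht : t ∈ Ico (0:ℝ) 1) : gaussMap (uk k t) = t := by
  unfold gaussMap
  rw [if_neg (uk_pos k ht.1).ne', uk_floor k ht, uk_inv]
  push_cast; ring

lemma uk_inj (k : ℕ) : Set.InjOn (uk k) (Ico 0 1) := by
  intro x hx y hy h
  rw [← gauss_uk k hx, h, gauss_uk k hy]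

lemma uk_union : (⋃ k : ℕ, uk k '' Ico (0:ℝ) 1) = Ioc (0:ℝ) 1 := by
  ext x
  simp only [mem_iUnion, mem_image]
  constructor
  · rintro ⟨k, t, ht, rfl⟩
    exact ⟨uk_pos k ht.1, (uk_mem k ht.1).2⟩
  · rintro ⟨h0, h1⟩
    have hf : 1 ≤ ⌊1 / x⌋ := by
      rw [Int.le_floor]; push_cast; rw [le_div_iff₀ h0]; linarith
    obtain ⟨k, hk⟩ : ∃ k : ℕ, ⌊1 / x⌋ = (k:ℤ) + 1 := by
      refine ⟨(⌊1/x⌋ - 1).toNat, ?_⟩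
      rw [Int.toNat_of_nonneg (by omega)]; ring
    have hk' : (⌊1 / x⌋ : ℝ) = (k:ℝ) + 1 := by rw [hk]; push_cast; ring
    refine ⟨k, 1 / x - ⌊1/x⌋, ⟨by linarith [Int.floor_le (1/x)], by linarith [Int.lt_floor_add_one (1/x)]⟩, ?_⟩
    unfold uk
    rw [hk']
    rw [show (k:ℝ) + 1 + (1 / x - (k + 1)) = 1 / x by ring, one_div_one_div]

lemma uk_disj : Pairwise (Function.onFun Disjoint fun k : ℕ => uk k '' Ico (0:ℝ) 1) := by
  intro i j hij
  rw [Function.onFun, Set.disjoint_left]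
  rintro _ ⟨t, ht, rfl⟩ ⟨s, hs, h⟩
  apply hij
  have := uk_floor i ht
  rw [← h, uk_floor j hs] at this
  omega

lemma uk_deriv (k : ℕ) (t : ℝ) (ht : t ∈ Ico (0:ℝ) 1) :
    HasDerivWithinAt (uk k) (-1 / (k + 1 + t) ^ 2) (Ico 0 1) t := by
  unfold uk
  have h1 : (k:ℝ) + 1 + t ≠ 0 := by have := ht.1; positivity
  have := ((hasDerivAt_id t).const_add ((k:ℝ) + 1)).inv h1
  have h2 : HasDerivAt (fun t : ℝ => 1 / ((k:ℝ) + 1 + t)) (-1 / (k + 1 + t) ^ 2) t := by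
    have h3 := this
    simp only [id] at h3
    have e : (fun t : ℝ => 1 / ((k:ℝ) + 1 + t)) = (fun x : ℝ => (k:ℝ) + 1 + x)⁻¹ := by
      ext; simp
    rw [e]; exact h3
  exact h2.hasDerivWithinAt

lemma uk_meas (k : ℕ) : Measurable (uk k) := by unfold uk; fun_prop

lemma uk_image_meas (k : ℕ) : MeasurableSet (uk k '' Ico (0:ℝ) 1) :=
  measurableSet_Ico.image_of_measurable_injOn (uk_meas k) (uk_inj k)

lemma cov {h : ℝ → ℂ} (hh : IntegrableOn h (Ioc 0 1)) :
    HasSum (fun k : ℕ => ∫ t in Ico (0:ℝ) 1, |-1 / ((k:ℝ) + 1 + t) ^ 2| • h (uk k t))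
      (∫ x in Ioc (0:ℝ) 1, h x) := by
  have := hasSum_integral_iUnion (μ := volume) (f := h) uk_image_meas uk_disj (by rwa [uk_union])
  rw [uk_union] at this
  have e : (fun k : ℕ => ∫ x in uk k '' Ico 0 1, h x) =
      fun k : ℕ => ∫ t in Ico (0:ℝ) 1, |-1 / ((k:ℝ) + 1 + t) ^ 2| • h (uk k t) := by
    ext k
    rw [integral_image_eq_integral_abs_deriv_smul measurableSet_Ico (uk_deriv k) (uk_inj k)]
  rwa [e] at this

lemma cov_int {h : ℝ → ℂ} (hh : IntegrableOn h (Ioc 0 1)) (k : ℕ) :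
    IntegrableOn (fun t => |-1 / ((k:ℝ) + 1 + t) ^ 2| • h (uk k t)) (Ico 0 1) := by
  rw [← integrableOn_image_iff_integrableOn_abs_deriv_smul measurableSet_Ico (uk_deriv k) (uk_inj k)]
  refine hh.mono_set ?_
  rw [← uk_union]
  exact subset_iUnion (fun k => uk k '' Ico (0:ℝ) 1) k

lemma cov_norm {h : ℝ → ℂ} (hh : IntegrableOn h (Ioc 0 1)) :
    Summable (fun k : ℕ => ∫ t in Ico (0:ℝ) 1, ‖|-1 / ((k:ℝ) + 1 + t) ^ 2| • h (uk k t)‖) := by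
  have h2 : IntegrableOn (fun x => ‖h x‖) (Ioc 0 1) := hh.norm
  have := hasSum_integral_iUnion (μ := volume) (f := fun x => ‖h x‖) uk_image_meas uk_disj (by rwa [uk_union])
  have e : (fun k : ℕ => ∫ x in uk k '' Ico 0 1, ‖h x‖) =
      fun k : ℕ => ∫ t in Ico (0:ℝ) 1, ‖|-1 / ((k:ℝ) + 1 + t) ^ 2| • h (uk k t)‖ := by
    ext k
    rw [integral_image_eq_integral_abs_deriv_smul measurableSet_Ico (uk_deriv k) (uk_inj k)]
    simp only [norm_smul, Real.norm_eq_abs, abs_abs, smul_eq_mul]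
  rw [e] at this
  exact this.summable

/-- density of the Gauss measure -/
noncomputable def gw (x : ℝ) : ℝ := 1 / (Real.log 2 * (1 + x))

noncomputable def gm : Measure ℝ :=
  (volume.restrict (Ioo (0:ℝ) 1)).withDensity (fun x => ENNReal.ofReal (gw x))

lemma gw_meas : Measurable gw := by unfold gw; fun_prop
lemma log2_pos : 0 < Real.log 2 := Real.log_pos one_lt_two
lemma gw_nonneg {x : ℝ} (hx : 0 ≤ x) : 0 ≤ gw x := by
  unfold gw; have := log2_pos; positivity
lemma gw_le {x : ℝ} (hx : 0 ≤ x) : gw x ≤ 1 / Real.log 2 := by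
  unfold gw
  have := log2_pos
  apply one_div_le_one_div_of_le this
  nlinarith

lemma gw_uk (k : ℕ) {t : ℝ} (ht : 0 ≤ t) :
    |-1 / ((k:ℝ) + 1 + t) ^ 2| * gw (uk k t) = gw t * pk k t := by
  have h1 : (0:ℝ) < k + 1 + t := by positivity
  have h2 : (0:ℝ) < k + 2 + t := by positivity
  rw [abs_div, abs_neg, abs_one, abs_of_pos (show (0:ℝ) < (k + 1 + t) ^ 2 by positivity)]
  unfold gw uk pk
  have h3 := log2_pos
  have h4 : (0:ℝ) < 1 + t := by positivity
  have h5 : 1 + 1 / ((k:ℝ) + 1 + t) = (k + 2 + t) / (k + 1 + t) := by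
    field_simp; ring
  rw [h5]
  field_simp

section
variable {E : Type*} [NormedAddCommGroup E] [NormedSpace ℝ E]

lemma integral_gm (H : ℝ → E) : ∫ x, H x ∂gm = ∫ x in Ioo (0:ℝ) 1, gw x • H x := by
  unfold gm
  rw [integral_withDensity_eq_integral_toReal_smul (by have := gw_meas; fun_prop) (by simp)]
  refine setIntegral_congr_fun measurableSet_Ioo fun x hx => ?_
  rw [ENNReal.toReal_ofReal (gw_nonneg hx.1.le)]

lemma integrable_gm (H : ℝ → E) : Integrable H gm ↔ IntegrableOn (fun x => gw x • H x) (Ioo (0:ℝ) 1) := by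
  unfold gm
  rw [integrable_withDensity_iff_integrable_smul' (by have := gw_meas; fun_prop) (by simp)]
  refine integrableOn_congr_fun (fun x hx => ?_) measurableSet_Ioo
  rw [ENNReal.toReal_ofReal (gw_nonneg hx.1.le)]

lemma integrable_gm_of {H : ℝ → E} (h : IntegrableOn H (Ioo (0:ℝ) 1)) : Integrable H gm := by
  rw [integrable_gm]
  refine Integrable.bdd_smul (C := 1 / Real.log 2) h gw_meas.aestronglyMeasurable ?_
  filter_upwards [ae_restrict_mem measurableSet_Ioo] with x hx
  rw [Real.norm_eq_abs, abs_of_nonneg (gw_nonneg hx.1.le)]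
  exact gw_le hx.1.le
end

instance gm_prob : IsProbabilityMeasure gm := by
  constructor
  unfold gm
  rw [withDensity_apply _ MeasurableSet.univ, Measure.restrict_univ]
  rw [← ofReal_integral_eq_lintegral_ofReal]
  · rw [← integral_Ioc_eq_integral_Ioo, ← intervalIntegral.integral_of_le zero_le_one]
    have : ∫ x in (0:ℝ)..1, gw x = 1 := by
      have h : ∀ x ∈ uIcc (0:ℝ) 1, HasDerivAt (fun x => Real.log (1 + x) / Real.log 2) (gw x) x := by
        intro x hx
        rw [uIcc_of_le zero_le_one] at hx
        have h1 : (1:ℝ) + x ≠ 0 := by linarith [hx.1]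
        have := (((hasDerivAt_id x).const_add 1).log h1).div_const (Real.log 2)
        have e : gw x = 1 / (1 + x) / Real.log 2 := by
          unfold gw
          rw [div_div, mul_comm]
        rw [e]
        exact this
      rw [intervalIntegral.integral_eq_sub_of_hasDerivAt h]
      · have := log2_pos.ne'
        norm_num [this]
      · refine ContinuousOn.intervalIntegrable ?_
        intro x hx
        rw [uIcc_of_le zero_le_one] at hx
        have h1 : (1:ℝ) + x ≠ 0 := by linarith [hx.1]
        have h2 := log2_pos.ne'
        unfold gw
        exact (ContinuousAt.div (by fun_prop) (by fun_prop) (by positivity)).continuousWithinAt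
    rw [this]; simp
  · have h : IntegrableOn (fun _ : ℝ => (1:ℝ)) (Ioo (0:ℝ) 1) := by simp
    have := (integrable_gm (E := ℝ) (fun _ => (1:ℝ))).1 (integrable_gm_of h)
    simp only [smul_eq_mul, mul_one] at this
    exact this
  · filter_upwards [ae_restrict_mem measurableSet_Ioo] with x hx using gw_nonneg hx.1.le

lemma gauss_meas : Measurable gaussMap := by
  unfold gaussMap
  refine Measurable.ite (measurableSet_singleton 0) measurable_const ?_
  fun_prop

lemma duality {F : ℝ → ℝ} (hF : Integrable F gm) {G : ℝ → ℂ} (hG : Measurable G) (B : ℝ)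
    (hB : ∀ x, ‖G x‖ ≤ B) :
    ∫ x, (F x : ℂ) * G (gaussMap x) ∂gm = ∫ x, (gL F x : ℂ) * G x ∂gm := by
  rw [integral_gm, integral_gm]
  have hi : Integrable (fun x => (F x : ℂ) * G (gaussMap x)) gm := by
    have h1 : Integrable (fun x => (F x : ℂ)) gm := hF.ofReal
    exact h1.mul_bdd (c := B) (hG.comp gauss_meas).aestronglyMeasurable (by simp [hB])
  have hi2 := (integrable_gm _).1 hi
  rw [← integrableOn_Ioc_iff_integrableOn_Ioo] at hi2
  have c1 := cov hi2
  have c2 := cov_int hi2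
  have c3 := cov_norm hi2
  have c4 := hasSum_integral_of_summable_integral_norm c2 c3
  have c5 := c1.unique c4
  rw [integral_Ioc_eq_integral_Ioo] at c5
  rw [c5, integral_Ico_eq_integral_Ioo]
  refine setIntegral_congr_fun measurableSet_Ioo fun t ht => ?_
  have ht' : t ∈ Ico (0:ℝ) 1 := ⟨ht.1.le, ht.2⟩
  have e : ∀ k : ℕ, |-1 / ((k:ℝ) + 1 + t) ^ 2| • gw (uk k t) • ((F (uk k t) : ℂ) * G (gaussMap (uk k t)))
      = (gw t : ℂ) * ((pk k t * F (uk k t) : ℝ) : ℂ) * G t := by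
    intro k
    rw [gauss_uk k ht', smul_smul, gw_uk k ht.1.le, Complex.real_smul]
    push_cast; ring
  simp_rw [e]
  rw [tsum_mul_right, tsum_mul_left, ← Complex.ofReal_tsum, Complex.real_smul]
  unfold gL
  rw [cl_of_mem ht.1.le ht.2.le]
  ring

lemma gauss_mp : MeasurePreserving gaussMap gm gm := by
  refine ⟨gauss_meas, ?_⟩
  ext s hs
  rw [Measure.map_apply gauss_meas hs]
  have := duality (F := fun _ => 1) (integrable_const 1) (G := s.indicator (fun _ => (1:ℂ)))
    (measurable_const.indicator hs) 1 (by intro x; by_cases h : x ∈ s <;> simp [h])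
  simp only [gL_const, Complex.ofReal_one, one_mul] at this
  have e : ∀ x, s.indicator (fun _ => (1:ℂ)) (gaussMap x) = (gaussMap ⁻¹' s).indicator (fun _ => (1:ℂ)) x := by
    intro x; rfl
  simp_rw [e] at this
  rw [integral_indicator_const _ hs, integral_indicator_const _ (gauss_meas hs)] at this
  simp only [Complex.real_smul, mul_one, Complex.ofReal_inj] at this
  exact (measureReal_eq_measureReal_iff).1 this

end KnCLT


namespace KnCLT

lemma gm_ae_mem : ∀ᵐ x ∂gm, x ∈ Ioo (0:ℝ) 1 := by
  unfold gm
  exact (withDensity_absolutelyContinuous _ _).ae_le (ae_restrict_mem measurableSet_Ioo)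

lemma vol_ac_gm : volume.restrict (Ioo (0:ℝ) 1) ≪ gm := by
  unfold gm
  refine withDensity_absolutelyContinuous' (by have := gw_meas; fun_prop) ?_
  filter_upwards [ae_restrict_mem measurableSet_Ioo] with x hx
  have : 0 < gw x := by
    unfold gw; have := log2_pos; have := hx.1; positivity
  simpa using this

lemma lip_cont {K : ℝ} {ψ : ℝ → ℝ} (h : ∀ x y, |ψ x - ψ y| ≤ K * |x - y|) : Continuous ψ := by
  have hK : 0 ≤ K := by simpa using (abs_nonneg _).trans (h 1 0)
  have : LipschitzWith ⟨K, hK⟩ ψ := LipschitzWith.of_dist_le_mul fun x y => by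
    rw [Real.dist_eq, Real.dist_eq]; exact h x y
  exact this.continuous

lemma mean_bdd {K : ℝ} {ψ : ℝ → ℝ} (h : ∀ x y, |ψ x - ψ y| ≤ K * |x - y|)
    (hcl : ∀ x, ψ (cl x) = ψ x) (hm : ∫ x, ψ x ∂gm = 0) (x : ℝ) : |ψ x| ≤ K := by
  have hK : 0 ≤ K := by simpa using (abs_nonneg _).trans (h 1 0)
  have hi : Integrable ψ gm := by
    refine Integrable.of_bound (lip_cont h).aestronglyMeasurable (|ψ 0| + K) ?_
    refine Eventually.of_forall fun y => ?_
    rw [← hcl y]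
    exact LipI.bdd (fun a b _ _ _ _ => h a b) (cl_nonneg y) (cl_le y)
  have e : ψ x = ∫ y, (ψ x - ψ y) ∂gm := by
    rw [integral_sub (integrable_const _) hi, hm]; simp
  rw [e, ← Real.norm_eq_abs]
  refine (norm_integral_le_of_norm_le_const (C := K) ?_).trans (by simp)
  filter_upwards [gm_ae_mem] with y hy
  rw [← hcl x]
  refine (h _ _).trans ?_
  have h1 := cl_nonneg x
  have h2 := cl_le x
  have : |cl x - y| ≤ 1 := by rw [abs_le]; constructor <;> linarith [hy.1, hy.2]
  nlinarith

lemma gL_int {ψ : ℝ → ℝ} (hi : Integrable ψ gm) :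
    ∫ x, gL ψ x ∂gm = ∫ x, ψ x ∂gm := by
  have := duality hi (G := fun _ => 1) measurable_const 1 (by simp)
  simp only [mul_one] at this
  rw [integral_complex_ofReal, integral_complex_ofReal] at this
  exact_mod_cast this.symm

lemma poisson {K : ℝ} {ψ : ℝ → ℝ} (h : LipI K ψ) (hcl : ∀ x, ψ (cl x) = ψ x)
    (hm : ∫ x, ψ x ∂gm = 0) :
    ∃ (b : ℝ → ℝ) (B : ℝ), Measurable b ∧ (∀ x, |b x| ≤ B) ∧ (∀ x y, |b x - b y| ≤ B * |x - y|) ∧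
      ∀ G : ℝ → ℂ, Measurable G → (∀ x, ‖G x‖ ≤ 1) →
        ∫ x, (b x : ℂ) * G (gaussMap x) ∂gm = ∫ x, (b x : ℂ) * G x ∂gm - ∫ x, (ψ x : ℂ) * G x ∂gm := by
  have hK := h.nonneg
  let P : ℕ → ℝ → ℝ := fun n => gL^[n] ψ
  have P0 : P 0 = ψ := rfl
  have PS : ∀ n, P (n+1) = gL (P n) := fun n => Function.iterate_succ_apply' gL n ψ
  have Pcl : ∀ n x, P n (cl x) = P n x := by
    intro n x
    cases n with
    | zero => exact hcl x
    | succ n => rw [PS]; exact gL_cl _ _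
  have Plip : ∀ n x y, |P n x - P n y| ≤ (K * (5/6)^n) * |x - y| := by
    intro n
    induction n with
    | zero =>
      intro x y
      rw [← Pcl 0 x, ← Pcl 0 y, pow_zero, mul_one]
      exact (h _ _ (cl_nonneg x) (cl_le x) (cl_nonneg y) (cl_le y)).trans
        (mul_le_mul_of_nonneg_left (cl_lip x y) hK)
    | succ n ih =>
      intro x y
      rw [PS]
      refine (gL_contract (K := K * (5/6)^n) (fun a b _ _ _ _ => ih a b) x y).trans ?_
      rw [pow_succ]; apply le_of_eq; ring
  have Pcont : ∀ n, Continuous (P n) := fun n => lip_cont (Plip n)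
  have Pint0 : ∀ n, Integrable (P n) gm := by
    intro n
    refine Integrable.of_bound (Pcont n).aestronglyMeasurable (|P n 0| + K * (5/6)^n) ?_
    refine Eventually.of_forall fun y => ?_
    rw [← Pcl n y]
    exact LipI.bdd (fun a b _ _ _ _ => Plip n a b) (cl_nonneg y) (cl_le y)
  have Pm : ∀ n, ∫ x, P n x ∂gm = 0 := by
    intro n
    induction n with
    | zero => exact hm
    | succ n ih => rw [PS, gL_int (Pint0 n)]; exact ih
  have Pb : ∀ n x, |P n x| ≤ K * (5/6)^n := fun n x => mean_bdd (Plip n) (Pcl n) (Pm n) x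
  have gs : HasSum (fun n : ℕ => K * (5/6:ℝ)^n) (6 * K) := by
    have := (hasSum_geometric_of_lt_one (r := 5/6) (by norm_num) (by norm_num)).mul_left K
    rwa [show K * (1 - 5 / 6 : ℝ)⁻¹ = 6 * K by norm_num; exact mul_comm _ _] at this
  have Psum : ∀ x, Summable (fun n => P n x) := fun x =>
    Summable.of_norm_bounded gs.summable fun n => Pb n x
  let b : ℝ → ℝ := fun x => ∑' n, P n x
  have blip : ∀ x y, |b x - b y| ≤ (6 * K) * |x - y| := by
    intro x y
    simp only [b]
    rw [← (Psum x).tsum_sub (Psum y)]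
    exact tsum_of_norm_bounded (f := fun n => P n x - P n y) (gs.mul_right |x - y|)
      fun n => Plip n x y
  have bcont : Continuous b := lip_cont blip
  have key : ∀ H : ℝ → ℂ, Measurable H → (∀ x, ‖H x‖ ≤ 1) →
      HasSum (fun n => ∫ x, (P n x : ℂ) * H x ∂gm) (∫ x, (b x : ℂ) * H x ∂gm) := by
    intro H hH hH1
    have hb : ∀ n x, ‖(P n x : ℂ) * H x‖ ≤ K * (5/6)^n := by
      intro n x
      rw [norm_mul, Complex.norm_real]
      have := mul_le_mul (Pb n x) (hH1 x) (norm_nonneg _) (by positivity)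
      simpa using this
    have hi : ∀ n, Integrable (fun x => (P n x : ℂ) * H x) gm := by
      intro n
      refine Integrable.of_bound ?_ (K * (5/6)^n) (Eventually.of_forall (hb n))
      exact ((Complex.continuous_ofReal.comp (Pcont n)).measurable.mul hH).aestronglyMeasurable
    have := hasSum_integral_of_summable_integral_norm hi (by
      refine Summable.of_nonneg_of_le (fun n => integral_nonneg fun x => norm_nonneg _) (fun n => ?_) gs.summable
      have := integral_mono (hi n).norm (integrable_const (K * (5/6)^n)) (hb n)
      simpa using this)
    have e : (fun x => (b x : ℂ) * H x) = fun x => ∑' n, (P n x : ℂ) * H x := by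
      ext x
      rw [tsum_mul_right, ← Complex.ofReal_tsum]
    rw [e]; exact this
  refine ⟨b, 6 * K, bcont.measurable, fun x => ?_, blip, fun G hG hG1 => ?_⟩
  · exact tsum_of_norm_bounded (f := fun n => P n x) gs fun n => Pb n x
  · have k1 := key (fun x => G (gaussMap x)) (hG.comp gauss_meas) (fun x => hG1 _)
    have k2 := key G hG hG1
    have e : ∀ n, ∫ x, (P n x : ℂ) * G (gaussMap x) ∂gm = ∫ x, (P (n+1) x : ℂ) * G x ∂gm := by
      intro n
      rw [duality (Pint0 n) hG 1 hG1, PS]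
    simp_rw [e] at k1
    have k3 := (hasSum_nat_add_iff' 1).2 k2
    rw [Finset.sum_range_one] at k3
    exact k1.unique k3

/-- integrability facts for the logarithm -/
lemma log3_int : IntegrableOn (fun x : ℝ => |Real.log x| ^ 3) (Ioo 0 1) := by
  have h1 : IntegrableOn (fun x : ℝ => 216 * x ^ (-(1/2) : ℝ)) (Ioo 0 1) := by
    have := (intervalIntegral.intervalIntegrable_rpow' (a := 0) (b := 1) (r := -(1/2)) (by norm_num)).const_mul 216
    rw [intervalIntegrable_iff_integrableOn_Ioo_of_le zero_le_one] at this
    exact this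
  refine h1.mono' ?_ ?_
  · exact (by fun_prop : Measurable fun x : ℝ => |Real.log x| ^ 3).aestronglyMeasurable
  · filter_upwards [ae_restrict_mem measurableSet_Ioo] with x hx
    have h2 := Real.abs_log_mul_self_rpow_lt x (1/6) hx.1 hx.2.le (by norm_num)
    rw [Real.norm_eq_abs, abs_of_nonneg (by positivity)]
    have hp : 0 < x ^ (1/6:ℝ) := Real.rpow_pos_of_pos hx.1 _
    rw [abs_mul, abs_of_pos hp] at h2
    have h3 : (|Real.log x| * x ^ (1/6:ℝ))^3 ≤ 6^3 := by
      apply pow_le_pow_left₀ (by positivity)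
      norm_num at h2 ⊢
      exact h2.le
    have h4 : (x ^ (1/6:ℝ))^3 = x ^ (1/2:ℝ) := by
      rw [← Real.rpow_natCast, ← Real.rpow_mul hx.1.le]; norm_num
    rw [mul_pow, h4] at h3
    rw [Real.rpow_neg hx.1.le, ← div_eq_mul_inv, le_div_iff₀ (Real.rpow_pos_of_pos hx.1 _)]
    norm_num at h3 ⊢
    exact h3

noncomputable def kap : ℝ := Real.pi ^ 2 / (12 * Real.log 2)

noncomputable def gf (x : ℝ) : ℝ := -Real.log x - kap

lemma gf_meas : Measurable gf := by unfold gf; fun_prop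

lemma kap_pos : 0 < kap := by unfold kap; have := log2_pos; have := Real.pi_pos; positivity

lemma gf3_int : Integrable (fun x => |gf x| ^ 3) gm := by
  apply integrable_gm_of
  have h1 : IntegrableOn (fun x : ℝ => 4 * |Real.log x| ^ 3 + 4 * kap ^ 3) (Ioo 0 1) :=
    (log3_int.const_mul 4).add (integrable_const _)
  refine h1.mono' ?_ ?_
  · have := gf_meas
    exact (by fun_prop : Measurable fun x : ℝ => |gf x| ^ 3).aestronglyMeasurable
  · filter_upwards with x
    rw [Real.norm_eq_abs, abs_of_nonneg (by positivity)]
    have h2 : |gf x| ≤ |Real.log x| + kap := by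
      unfold gf
      refine (abs_sub _ _).trans ?_
      rw [abs_neg, abs_of_pos kap_pos]
    have h3 : |gf x| ^ 3 ≤ (|Real.log x| + kap) ^ 3 := pow_le_pow_left₀ (abs_nonneg _) h2 3
    have h4 := kap_pos.le
    have h5 := abs_nonneg (Real.log x)
    nlinarith [mul_nonneg (add_nonneg h5 h4) (sq_nonneg (|Real.log x| - kap))]

lemma gf2_int : Integrable (fun x => gf x ^ 2) gm := by
  refine ((integrable_const (1:ℝ)).add gf3_int).mono' ?_ ?_
  · have := gf_meas
    exact (by fun_prop : Measurable fun x : ℝ => gf x ^ 2).aestronglyMeasurable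
  · filter_upwards with x
    rw [Real.norm_eq_abs, abs_of_nonneg (by positivity), ← sq_abs, Pi.add_apply]
    have := abs_nonneg (gf x)
    nlinarith [mul_nonneg (add_nonneg this zero_le_one) (sq_nonneg (|gf x| - 1))]

lemma gf_int : Integrable gf gm := by
  refine ((integrable_const (1:ℝ)).add gf2_int).mono' gf_meas.aestronglyMeasurable ?_
  filter_upwards with x
  rw [Real.norm_eq_abs, Pi.add_apply, ← sq_abs]
  have := abs_nonneg (gf x)
  nlinarith [sq_nonneg (|gf x| - 1)]

lemma log_diff (k : ℕ) {x y : ℝ} (hx : 0 ≤ x) (hy : 0 ≤ y) :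
    |gf (uk k x) - gf (uk k y)| ≤ |x - y| / (k + 1) := by
  have key : ∀ a b : ℝ, 0 ≤ a → a ≤ b → Real.log (k + 1 + b) - Real.log (k + 1 + a) ≤ (b - a) / (k + 1) := by
    intro a b ha hab
    have h1 : (0:ℝ) < k + 1 + a := by positivity
    have h2 : (0:ℝ) < k + 1 + b := by have : 0 ≤ b := ha.trans hab
                                      positivity
    rw [← Real.log_div h2.ne' h1.ne']
    refine (Real.log_le_sub_one_of_pos (by positivity)).trans ?_
    rw [show ((k:ℝ) + 1 + b) / (k + 1 + a) - 1 = (b - a) / (k + 1 + a) by field_simp; ring]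
    exact div_le_div_of_nonneg_left (by linarith) (by positivity) (by linarith)
  have mono : ∀ a b : ℝ, 0 ≤ a → a ≤ b → Real.log (k + 1 + a) ≤ Real.log (k + 1 + b) := by
    intro a b ha hab
    exact Real.log_le_log (by positivity) (by linarith)
  have e : gf (uk k x) - gf (uk k y) = Real.log (k + 1 + x) - Real.log (k + 1 + y) := by
    unfold gf uk
    rw [one_div, one_div, Real.log_inv, Real.log_inv]; ring
  rw [e]
  rcases le_total x y with h | h
  · rw [abs_sub_comm x y, abs_sub_comm, abs_of_nonneg (by linarith [mono x y hx h]), abs_of_nonneg (by linarith)]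
    exact key x y hx h
  · rw [abs_of_nonneg (by linarith [mono y x hy h]), abs_of_nonneg (by linarith)]
    exact key y x hy h

lemma gf_uk_nn (k : ℕ) {x : ℝ} (hx : 0 ≤ x) (hx1 : x ≤ 1) :
    |gf (uk k x)| ≤ (1 + kap) * (k + 1) ∧ gf (uk k x) ^ 2 ≤ (64 + 2 * kap ^ 2) * Real.sqrt (k + 1) := by
  have hk := kap_pos
  have hkk : (0:ℝ) ≤ k := by positivity
  have hs : (0:ℝ) < k + 1 + x := by positivity
  have e : gf (uk k x) = Real.log (k + 1 + x) - kap := by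
    unfold gf uk
    rw [one_div, Real.log_inv]; ring
  have h0 : 0 ≤ Real.log (k + 1 + x) := Real.log_nonneg (by linarith)
  have h1 : Real.log (k + 1 + x) ≤ k + 1 := by
    have := Real.log_le_sub_one_of_pos hs
    linarith
  rw [e]
  constructor
  · rw [abs_le]; constructor <;> nlinarith
  · have h2 : Real.log (k + 1 + x) ^ 2 ≤ 32 * Real.sqrt (k + 1) := by
      have a := Real.sqrt_nonneg ((k:ℝ) + 1 + x)
      have a1 := Real.sq_sqrt hs.le
      have a2 := Real.sqrt_nonneg (Real.sqrt ((k:ℝ) + 1 + x))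
      have a3 := Real.sq_sqrt a
      have b1 : Real.log (k + 1 + x) = 4 * Real.log (Real.sqrt (Real.sqrt (k + 1 + x))) := by
        rw [Real.log_sqrt a, Real.log_sqrt hs.le]; ring
      have b2 := Real.log_le_self a2
      have b3 : Real.log (k + 1 + x) ^ 2 ≤ (4 * Real.sqrt (Real.sqrt (k + 1 + x))) ^ 2 :=
        pow_le_pow_left₀ h0 (by linarith) 2
      have b4 : Real.sqrt ((k:ℝ) + 1 + x) ≤ 2 * Real.sqrt (k + 1) := by
        rw [show 2 * Real.sqrt ((k:ℝ) + 1) = Real.sqrt (4 * (k + 1)) by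
          rw [Real.sqrt_mul (by norm_num), show (4:ℝ) = 2 ^ 2 by norm_num, Real.sqrt_sq (by norm_num)]]
        apply Real.sqrt_le_sqrt
        linarith
      nlinarith
    have h3 : 1 ≤ Real.sqrt ((k:ℝ) + 1) := by
      rw [Real.one_le_sqrt]; linarith
    nlinarith [sq_nonneg (Real.log (k + 1 + x) + kap), sq_nonneg kap]

lemma gf_good : ∃ C, Good C gf := by
  refine ⟨1 + (64 + 2 * kap ^ 2), fun k x y hx hx1 hy hy1 => ⟨?_, ?_⟩⟩
  · have h := (gf_uk_nn k hx hx1).2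
    have h3 : 1 ≤ Real.sqrt ((k:ℝ) + 1) := by
      rw [Real.one_le_sqrt]; linarith [show (0:ℝ) ≤ k by positivity]
    rw [← sq_abs] at h
    nlinarith [sq_nonneg (|gf (uk k x)| - 1)]
  · refine (log_diff k hx hy).trans ?_
    have : |x - y| / (k + 1) ≤ |x - y| := div_le_self (abs_nonneg _) (by linarith [show (0:ℝ) ≤ k by positivity])
    nlinarith [sq_nonneg kap, abs_nonneg (x - y)]

lemma F_good {b : ℝ → ℝ} {B : ℝ} (hb : ∀ x, |b x| ≤ B) (hl : ∀ x y, |b x - b y| ≤ B * |x - y|) :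
    ∃ C, Good C (fun x => gf x ^ 2 / 2 + gf x * b x) := by
  have hB : 0 ≤ B := (abs_nonneg _).trans (hb 0)
  have hk := kap_pos
  set M := 64 + 2 * kap ^ 2 with hM
  have hM0 : 0 ≤ M := by positivity
  refine ⟨(M + B ^ 2) + ((1 + kap) + B + (1 + kap) * B), fun k x y hx hx1 hy hy1 => ⟨?_, ?_⟩⟩
  · have h := (gf_uk_nn k hx hx1).2
    have h3 : 1 ≤ Real.sqrt ((k:ℝ) + 1) := by
      rw [Real.one_le_sqrt]; linarith [show (0:ℝ) ≤ k by positivity]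
    have h4 : |gf (uk k x) ^ 2 / 2 + gf (uk k x) * b (uk k x)| ≤ gf (uk k x) ^ 2 + B ^ 2 := by
      have h5 : b (uk k x) ^ 2 ≤ B ^ 2 := by rw [← sq_abs]; exact pow_le_pow_left₀ (abs_nonneg _) (hb _) 2
      rw [abs_le]
      constructor <;> nlinarith [sq_nonneg (gf (uk k x) - b (uk k x)), sq_nonneg (gf (uk k x) + b (uk k x))]
    refine h4.trans ?_
    have h6 : 0 ≤ ((1 + kap) + B + (1 + kap) * B) * Real.sqrt ((k:ℝ) + 1) := by positivity
    nlinarith [sq_nonneg B]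
  · set u := uk k x
    set u' := uk k y
    have hk1 : (1:ℝ) ≤ k + 1 := by linarith [show (0:ℝ) ≤ k by positivity]
    have d1 : |gf u - gf u'| ≤ |x - y| / (k + 1) := log_diff k hx hy
    have d2 : |b u - b u'| ≤ B * (|x - y| / (k + 1)) := by
      refine (hl u u').trans (mul_le_mul_of_nonneg_left ?_ hB)
      rw [uk_diff k hx hy]
      apply div_le_div_of_nonneg_left (abs_nonneg _) (by positivity)
      nlinarith [mul_nonneg hx hy]
    have a1 := (gf_uk_nn k hx hx1).1
    have a2 := (gf_uk_nn k hy hy1).1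
    set d := |x - y| / ((k:ℝ) + 1) with hd
    have hd0 : 0 ≤ d := by positivity
    have hd1 : d * (k + 1) = |x - y| := by rw [hd]; field_simp
    have e : (gf u ^ 2 / 2 + gf u * b u) - (gf u' ^ 2 / 2 + gf u' * b u') =
      (gf u - gf u') * ((gf u + gf u') / 2) + (gf u - gf u') * b u + gf u' * (b u - b u') := by ring
    rw [e]
    refine (abs_add_three _ _ _).trans ?_
    rw [abs_mul, abs_mul, abs_mul]
    have s1 : |(gf u + gf u') / 2| ≤ (1 + kap) * (k + 1) := by
      rw [abs_div, abs_two, div_le_iff₀ two_pos]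
      have := abs_add_le (gf u) (gf u')
      linarith
    have t1 := mul_le_mul d1 s1 (abs_nonneg _) hd0
    have t2 := mul_le_mul d1 (hb u) (abs_nonneg _) hd0
    have t3 := mul_le_mul a2 d2 (abs_nonneg _) (by positivity)
    have t4 : d ≤ |x - y| := by rw [← hd1]; nlinarith
    have r1 : d * ((1 + kap) * (k + 1)) = (1 + kap) * |x - y| := by rw [← hd1]; ring
    have r3 : (1 + kap) * (k + 1) * (B * d) = (1 + kap) * B * |x - y| := by rw [← hd1]; ring
    have r2 : d * B ≤ B * |x - y| := by nlinarith
    have r4 : 0 ≤ (M + B^2) * |x - y| := by positivity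
    nlinarith

end KnCLT


namespace KnCLT

lemma pow_log_intble (n : ℕ) : IntervalIntegrable (fun x : ℝ => x ^ n * -Real.log x) volume 0 1 := by
  have := (intervalIntegral.intervalIntegrable_log' (a := 0) (b := 1)).neg
  exact this.continuousOn_mul (f := fun x : ℝ => -Real.log x) (g := fun x : ℝ => x ^ n) (by fun_prop)

lemma pow_log_integral (n : ℕ) : ∫ x in (0:ℝ)..1, x ^ n * -Real.log x = 1 / ((n:ℝ) + 1) ^ 2 := by
  have h := intervalIntegral.integral_eq_sub_of_hasDerivAt_of_le (a := 0) (b := 1)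
    (f := fun x : ℝ => - (x ^ n * (x * Real.log x)) / ((n:ℝ) + 1) + x ^ (n+1) / ((n:ℝ) + 1) ^ 2)
    (f' := fun x : ℝ => x ^ n * -Real.log x) zero_le_one ?_ ?_ (pow_log_intble n)
  · rw [h]; simp
  · have := Real.continuous_mul_log
    exact Continuous.continuousOn (by fun_prop)
  · intro x hx
    have hn : (n:ℝ) + 1 ≠ 0 := by positivity
    have h1 : HasDerivAt (fun x : ℝ => x ^ (n+1) * Real.log x)
        (((n+1:ℕ):ℝ) * x ^ n * Real.log x + x ^ (n+1) * x⁻¹) x := by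
      have := (hasDerivAt_pow (n+1) x).mul (Real.hasDerivAt_log hx.1.ne')
      rw [Nat.add_sub_cancel] at this
      exact this
    have h2 := (h1.neg.div_const ((n:ℝ) + 1)).add ((hasDerivAt_pow (n+1) x).div_const (((n:ℝ) + 1) ^ 2))
    have e1 : (fun x : ℝ => - (x ^ n * (x * Real.log x)) / ((n:ℝ) + 1) + x ^ (n+1) / ((n:ℝ) + 1) ^ 2)
      = (fun x => (-fun x : ℝ => x ^ (n+1) * Real.log x) x / ((n:ℝ) + 1)) + fun x => x ^ (n+1) / ((n:ℝ) + 1) ^ 2 := by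
      ext x; simp only [Pi.add_apply, Pi.neg_apply]; ring
    rw [e1]
    have e2 : x ^ n * -Real.log x = -(((n+1:ℕ):ℝ) * x ^ n * Real.log x + x ^ (n+1) * x⁻¹) / ((n:ℝ) + 1) +
       ((n+1:ℕ):ℝ) * x ^ (n + 1 - 1) / ((n:ℝ) + 1) ^ 2 := by
      have := hx.1.ne'
      rw [Nat.add_sub_cancel]
      push_cast
      field_simp
      ring
    rw [e2]
    exact h2

lemma alt_zeta : HasSum (fun j : ℕ => 1 / (2 * (j:ℝ) + 1) ^ 2 - 1 / (2 * (j:ℝ) + 2) ^ 2) (Real.pi ^ 2 / 12) := by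
  have hz := hasSum_zeta_two
  have he : HasSum (fun k : ℕ => 1 / (((2 * k : ℕ)):ℝ) ^ 2) (Real.pi ^ 2 / 6 / 4) := by
    have := hz.div_const 4
    have e : (fun k : ℕ => 1 / (((2 * k : ℕ)):ℝ) ^ 2) = fun k : ℕ => 1 / (k:ℝ) ^ 2 / 4 := by
      ext k
      push_cast
      rw [mul_pow, div_div]; ring
    rw [e]; exact this
  have hs : Summable (fun k : ℕ => 1 / ((2 * k + 1 : ℕ):ℝ) ^ 2) :=
    hz.summable.comp_injective (i := fun k : ℕ => 2 * k + 1) (fun a b h => by simpa using h)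
  have h1 := (HasSum.even_add_odd (f := fun n : ℕ => 1 / (n:ℝ) ^ 2) he hs.hasSum).unique hz
  have ho : HasSum (fun k : ℕ => 1 / ((2 * k + 1 : ℕ):ℝ) ^ 2) (Real.pi ^ 2 / 6 - Real.pi ^ 2 / 6 / 4) := by
    have := hs.hasSum
    rwa [show ∑' k : ℕ, 1 / ((2 * k + 1 : ℕ):ℝ) ^ 2 = Real.pi ^ 2 / 6 - Real.pi ^ 2 / 6 / 4 by linarith] at this
  have he2 := (hasSum_nat_add_iff' 1).2 he
  simp only [Finset.sum_range_one] at he2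
  have := ho.sub he2
  have e : Real.pi ^ 2 / 12 = Real.pi ^ 2 / 6 - Real.pi ^ 2 / 6 / 4 - (Real.pi ^ 2 / 6 / 4 - 1 / ((2 * 0 : ℕ):ℝ) ^ 2) := by
    simp; ring
  rw [e]
  refine this.congr_fun ?_
  intro k
  push_cast
  ring

lemma log_mean : ∫ x in Ioo (0:ℝ) 1, -Real.log x / (1 + x) = Real.pi ^ 2 / 12 := by
  have hI : ∀ n : ℕ, ∫ x in Ioo (0:ℝ) 1, x ^ n * -Real.log x = 1 / ((n:ℝ) + 1) ^ 2 := by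
    intro n
    rw [← pow_log_integral n, intervalIntegral.integral_of_le zero_le_one, integral_Ioc_eq_integral_Ioo]
  have hJ : ∀ n : ℕ, IntegrableOn (fun x : ℝ => x ^ n * -Real.log x) (Ioo 0 1) := by
    intro n
    exact (intervalIntegrable_iff_integrableOn_Ioo_of_le zero_le_one).1 (pow_log_intble n)
  have hF : ∀ j : ℕ, IntegrableOn (fun x : ℝ => x ^ (2 * j) * -Real.log x - x ^ (2 * j + 1) * -Real.log x) (Ioo 0 1) :=
    fun j => (hJ _).sub (hJ _)
  have hFi : ∀ j : ℕ, ∫ x in Ioo (0:ℝ) 1, (x ^ (2 * j) * -Real.log x - x ^ (2 * j + 1) * -Real.log x)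
      = 1 / (2 * (j:ℝ) + 1) ^ 2 - 1 / (2 * (j:ℝ) + 2) ^ 2 := by
    intro j
    rw [integral_sub (hJ _) (hJ _), hI, hI]
    push_cast; ring
  have hnn : ∀ j : ℕ, ∀ x ∈ Ioo (0:ℝ) 1, 0 ≤ x ^ (2 * j) * -Real.log x - x ^ (2 * j + 1) * -Real.log x := by
    intro j x hx
    have h1 : 0 ≤ -Real.log x := by linarith [Real.log_nonpos hx.1.le hx.2.le]
    have h2 : 0 ≤ x ^ (2 * j) := pow_nonneg hx.1.le _
    have h3 : x ^ (2 * j) * -Real.log x - x ^ (2 * j + 1) * -Real.log x = (x ^ (2 * j) * -Real.log x) * (1 - x) := by ring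
    rw [h3]
    exact mul_nonneg (mul_nonneg h2 h1) (by linarith [hx.2])
  have := hasSum_integral_of_summable_integral_norm hF (by
    convert alt_zeta.summable using 2 with j
    rw [← hFi j]
    refine setIntegral_congr_fun measurableSet_Ioo fun x hx => ?_
    exact (abs_of_nonneg (hnn j x hx)))
  simp_rw [hFi] at this
  rw [alt_zeta.unique this]
  refine setIntegral_congr_fun measurableSet_Ioo fun x hx => ?_
  have h1 : HasSum (fun j : ℕ => (x^2) ^ j) (1 - x^2)⁻¹ :=
    hasSum_geometric_of_lt_one (by positivity) (by nlinarith [hx.1, hx.2])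
  have h2 := h1.mul_right (-Real.log x * (1 - x))
  have h3 : (1 - x^2)⁻¹ * (-Real.log x * (1 - x)) = -Real.log x / (1 + x) := by
    have a1 : (1:ℝ) - x ≠ 0 := by linarith [hx.2]
    have a2 : (1:ℝ) + x ≠ 0 := by linarith [hx.1]
    rw [show (1 - x^2) = (1 - x) * (1 + x) by ring]
    field_simp
  rw [h3] at h2
  change -Real.log x / (1 + x) = _
  rw [← h2.tsum_eq]
  refine tsum_congr fun j => ?_
  rw [← pow_mul]; ring

lemma gf_mean : ∫ x, gf x ∂gm = 0 := by
  have h1 : Integrable (fun x => -Real.log x) gm := by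
    have := gf_int.add (integrable_const kap)
    refine this.congr (Eventually.of_forall fun x => ?_)
    simp [gf]
  unfold gf
  rw [integral_sub h1 (integrable_const _)]
  have h2 : ∫ x, -Real.log x ∂gm = kap := by
    rw [integral_gm]
    have e : ∀ x : ℝ, gw x • -Real.log x = (1 / Real.log 2) * (-Real.log x / (1 + x)) := by
      intro x; unfold gw; rw [smul_eq_mul]
      rw [one_div, mul_inv, one_div]; ring
    simp_rw [e]
    rw [integral_const_mul, log_mean]
    unfold kap
    have := log2_pos.ne'
    field_simp
  rw [h2]; simp

/-- density of Lebesgue measure with respect to the Gauss measure -/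
noncomputable def grho (x : ℝ) : ℝ := Real.log 2 * (1 + cl x)

lemma integral_rho {E : Type*} [NormedAddCommGroup E] [NormedSpace ℝ E] (H : ℝ → E) :
    ∫ x, grho x • H x ∂gm = ∫ x in Ioo (0:ℝ) 1, H x := by
  rw [integral_gm]
  refine setIntegral_congr_fun measurableSet_Ioo fun x hx => ?_
  simp only [smul_smul]
  unfold gw grho
  rw [cl_of_mem hx.1.le hx.2.le]
  have h1 : (1:ℝ) + x ≠ 0 := by linarith [hx.1]
  have h2 := log2_pos.ne'
  rw [show 1 / (Real.log 2 * (1 + x)) * (Real.log 2 * (1 + x)) = 1 by field_simp, one_smul]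

lemma lip_poisson_F {F : ℝ → ℝ} (hF : Integrable F gm) (hg : ∃ C, Good C F) (c : ℝ) (hc : ∫ x, F x ∂gm = c) :
    ∃ (b : ℝ → ℝ) (B : ℝ), Measurable b ∧ (∀ x, |b x| ≤ B) ∧ (∀ x y, |b x - b y| ≤ B * |x - y|) ∧
      ∀ G : ℝ → ℂ, Measurable G → (∀ x, ‖G x‖ ≤ 1) →
        ∫ x, ((F x + b x : ℝ) : ℂ) * G (gaussMap x) ∂gm = ∫ x, ((b x + c : ℝ) : ℂ) * G x ∂gm := by
  obtain ⟨C, hC⟩ := hg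
  obtain ⟨K, hK⟩ := good_lip hC
  have hLip : LipI K (fun x => gL F x - c) := by
    intro x y a1 a2 a3 a4
    simpa using hK x y a1 a2 a3 a4
  have hLb : ∀ x, |gL F x| ≤ |gL F 0| + K := by
    intro x
    rw [← gL_cl]
    exact hK.bdd (cl_nonneg x) (cl_le x)
  have hLm : Measurable (gL F) := by
    refine (lip_cont (K := K) fun x y => ?_).measurable
    rw [← gL_cl F x, ← gL_cl F y]
    exact (hK _ _ (cl_nonneg x) (cl_le x) (cl_nonneg y) (cl_le y)).trans
        (mul_le_mul_of_nonneg_left (cl_lip x y) hK.nonneg)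
  have hLi : Integrable (gL F) gm := Integrable.of_bound hLm.aestronglyMeasurable _ (Eventually.of_forall hLb)
  obtain ⟨b, B, mb, hb, hl, hG⟩ := poisson hLip (fun x => by rw [gL_cl]) (by
    rw [integral_sub hLi (integrable_const _), gL_int hF, hc]; simp)
  refine ⟨b, B, mb, hb, hl, fun G mG hG1 => ?_⟩
  have mG' : Measurable (fun x => G (gaussMap x)) := mG.comp gauss_meas
  have mul_i : ∀ (h : ℝ → ℝ) (H : ℝ → ℂ), Integrable h gm → Measurable H → (∀ x, ‖H x‖ ≤ 1) →
      Integrable (fun x => (h x : ℂ) * H x) gm := by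
    intro h H hh hH hH1
    have h1 : Integrable (fun x => (h x : ℂ)) gm := hh.ofReal
    exact h1.mul_bdd (c := 1) hH.aestronglyMeasurable (by simp [hH1])
  have bi : Integrable b gm := Integrable.of_bound mb.aestronglyMeasurable B (Eventually.of_forall hb)
  have ci : Integrable (fun x => gL F x - c) gm := hLi.sub (integrable_const _)
  have e1 : ∫ x, ((F x + b x : ℝ) : ℂ) * G (gaussMap x) ∂gm =
      ∫ x, (F x : ℂ) * G (gaussMap x) ∂gm + ∫ x, (b x : ℂ) * G (gaussMap x) ∂gm := by
    rw [← integral_add (mul_i F _ hF mG' fun x => hG1 _) (mul_i b _ bi mG' fun x => hG1 _)]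
    congr 1; ext x; push_cast; ring
  rw [e1, duality hF mG 1 hG1, hG G mG hG1]
  have i1 := mul_i b G bi mG hG1
  have i2 := mul_i _ G ci mG hG1
  have i3 := mul_i _ G hLi mG hG1
  have i4 : Integrable (fun x => (b x : ℂ) * G x - ((gL F x - c : ℝ) : ℂ) * G x) gm := i1.sub i2
  rw [← integral_sub i1 i2, ← integral_add i3 i4]
  congr 1; ext x; push_cast; ring

lemma var_pos {b : ℝ → ℝ} {B : ℝ} (mb : Measurable b) (hb : ∀ x, |b x| ≤ B)
    (D1 : ∀ G : ℝ → ℂ, Measurable G → (∀ x, ‖G x‖ ≤ 1) →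
        ∫ x, ((gf x + b x : ℝ) : ℂ) * G (gaussMap x) ∂gm = ∫ x, ((b x + 0 : ℝ) : ℂ) * G x ∂gm) :
    0 < ∫ x, (gf x ^ 2 / 2 + gf x * b x) ∂gm := by
  have hB : 0 ≤ B := (abs_nonneg _).trans (hb 0)
  set M := B + 1
  have hM : 0 < M := by positivity
  have bi : Integrable b gm := Integrable.of_bound mb.aestronglyMeasurable B (Eventually.of_forall hb)
  have mbT : Measurable (fun x => b (gaussMap x)) := mb.comp gauss_meas
  have d := D1 (fun x => ((b x / M : ℝ) : ℂ)) (by fun_prop) (by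
    intro x
    rw [Complex.norm_real, Real.norm_eq_abs, abs_div, abs_of_pos hM, div_le_one hM]
    linarith [hb x])
  have d' : ∫ x, (gf x + b x) * b (gaussMap x) ∂gm = ∫ x, b x ^ 2 ∂gm := by
    have e1 : ∀ x, ((gf x + b x : ℝ) : ℂ) * ((b (gaussMap x) / M : ℝ) : ℂ) =
      (((gf x + b x) * b (gaussMap x) / M : ℝ) : ℂ) := by intro x; push_cast; ring
    have e2 : ∀ x, ((b x + 0 : ℝ) : ℂ) * ((b x / M : ℝ) : ℂ) =
      ((b x ^ 2 / M : ℝ) : ℂ) := by intro x; push_cast; ring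
    simp_rw [e1, e2] at d
    rw [integral_complex_ofReal, integral_complex_ofReal, Complex.ofReal_inj, integral_div, integral_div,
      div_left_inj' hM.ne'] at d
    exact d
  have i1 : Integrable (fun x => gf x * b x) gm :=
    gf_int.mul_bdd (c := B) mb.aestronglyMeasurable (Eventually.of_forall hb)
  have i2 : Integrable (fun x => b x ^ 2) gm := by
    have := bi.mul_bdd (c := B) mb.aestronglyMeasurable (Eventually.of_forall hb)
    simpa [sq] using this
  have i3 : Integrable (fun x => (gf x + b x) * b (gaussMap x)) gm :=
    (gf_int.add bi).mul_bdd (c := B) mbT.aestronglyMeasurable (Eventually.of_forall fun x => hb _)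
  have i4 : Integrable (fun x => b (gaussMap x) ^ 2) gm :=
    gauss_mp.integrable_comp_of_integrable (g := fun x => b x ^ 2) i2
  have d4 : ∫ x, b (gaussMap x) ^ 2 ∂gm = ∫ x, b x ^ 2 ∂gm := by
    have := integral_map (μ := gm) (φ := gaussMap) gauss_meas.aemeasurable (f := fun x => b x ^ 2)
      (by rw [gauss_mp.map_eq]; exact i2.aestronglyMeasurable)
    rw [gauss_mp.map_eq] at this
    exact this.symm
  have i5 : Integrable (fun x => (gf x ^ 2 / 2 + gf x * b x)) gm := (gf2_int.div_const 2).add i1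
  have e : ∀ x, (gf x + b x - b (gaussMap x)) ^ 2 = 2 * (gf x ^ 2 / 2 + gf x * b x) + (b x ^ 2 + b (gaussMap x) ^ 2) -
      2 * ((gf x + b x) * b (gaussMap x)) := by intro x; ring
  have i6 : Integrable (fun x => 2 * (gf x ^ 2 / 2 + gf x * b x) + (b x ^ 2 + b (gaussMap x) ^ 2)) gm :=
    (i5.const_mul 2).add (i2.add i4)
  have i7 : Integrable (fun x => b x ^ 2 + b (gaussMap x) ^ 2) gm := i2.add i4
  have tot : ∫ x, (gf x + b x - b (gaussMap x)) ^ 2 ∂gm = 2 * ∫ x, (gf x ^ 2 / 2 + gf x * b x) ∂gm := by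
    simp_rw [e]
    rw [integral_sub i6 (i3.const_mul 2), integral_add (i5.const_mul 2) i7, integral_add i2 i4, d4,
      integral_const_mul, integral_const_mul, d']
    ring
  have isq : Integrable (fun x => (gf x + b x - b (gaussMap x)) ^ 2) gm := by
    simp_rw [e]; exact i6.sub (i3.const_mul 2)
  have nn : 0 ≤ ∫ x, (gf x + b x - b (gaussMap x)) ^ 2 ∂gm := integral_nonneg fun x => sq_nonneg _
  rcases nn.lt_or_eq with h | h
  · linarith
  · exfalso
    have h1 := (integral_eq_zero_iff_of_nonneg (fun x => sq_nonneg _) isq).1 h.symm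
    have h2 := vol_ac_gm.ae_le h1
    set ε := Real.exp (-(kap + 2 * B + 1)) with hε
    have hε0 : 0 < ε := Real.exp_pos _
    have hε1 : ε < 1 := by
      rw [hε, Real.exp_lt_one_iff]
      linarith [kap_pos]
    have h3 : ∀ᵐ x ∂(volume.restrict (Ioo (0:ℝ) 1)), x ∉ Ioo 0 ε := by
      filter_upwards [h2] with x hx hxe
      have h4 : gf x + b x - b (gaussMap x) = 0 := by simpa using hx
      have h5 : gf x > 2 * B := by
        unfold gf
        have : Real.log x < -(kap + 2 * B + 1) := by
          rw [Real.log_lt_iff_lt_exp hxe.1]; exact hxe.2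
        linarith
      have h6 := abs_le.1 (hb x)
      have h7 := abs_le.1 (hb (gaussMap x))
      linarith
    rw [ae_iff] at h3
    simp only [not_not] at h3
    rw [Measure.restrict_apply' measurableSet_Ioo] at h3
    have h4 : {a : ℝ | a ∈ Ioo 0 ε} ∩ Ioo 0 1 = Ioo 0 ε := by
      ext z; simp only [mem_inter_iff, mem_setOf_eq, mem_Ioo]
      constructor
      · exact fun h => h.1
      · exact fun h => ⟨h, h.1, h.2.trans hε1⟩
    rw [h4, Real.volume_Ioo] at h3
    simp at h3
    linarith

theorem gauss_charfun : ∃ v : ℝ, 0 < v ∧ ∀ s : ℝ,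
    Tendsto (fun n : ℕ => ∫ x in Ioo (0:ℝ) 1,
      Complex.exp (Complex.I * ((s / Real.sqrt n * birkhoffSum gaussMap gf n x : ℝ) : ℂ))) atTop
      (nhds (Complex.exp (-(v * s ^ 2 / 2 : ℝ)))) := by
  obtain ⟨b, B, mb, hb, hl, D1⟩ := lip_poisson_F gf_int gf_good 0 gf_mean
  have bi : Integrable b gm := Integrable.of_bound mb.aestronglyMeasurable B (Eventually.of_forall hb)
  have i1 : Integrable (fun x => gf x * b x) gm :=
    gf_int.mul_bdd (c := B) mb.aestronglyMeasurable (Eventually.of_forall hb)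
  have i5 : Integrable (fun x => (gf x ^ 2 / 2 + gf x * b x)) gm := (gf2_int.div_const 2).add i1
  have hpos := var_pos mb hb D1
  set I0 := ∫ x, (gf x ^ 2 / 2 + gf x * b x) ∂gm with hI0
  obtain ⟨e, B2, me, he, hle, D2⟩ := lip_poisson_F i5 (F_good hb hl) I0 rfl
  have hrl : LipI (Real.log 2) (fun x => grho x - 1) := by
    intro x y a1 a2 a3 a4
    unfold grho
    beta_reduce
    rw [cl_of_mem a1 a2, cl_of_mem a3 a4]
    rw [show Real.log 2 * (1 + x) - 1 - (Real.log 2 * (1 + y) - 1) = Real.log 2 * (x - y) by ring, abs_mul,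
      abs_of_pos log2_pos]
  have mr : Measurable grho := by
    unfold grho; have := cl_cont.measurable; fun_prop
  have ri : Integrable grho gm := by
    refine Integrable.of_bound mr.aestronglyMeasurable (Real.log 2 * 2) (Eventually.of_forall fun x => ?_)
    have := cl_nonneg x
    have := cl_le x
    have := log2_pos
    unfold grho
    rw [Real.norm_eq_abs, abs_of_nonneg (by positivity)]
    nlinarith
  have hrm : ∫ x, (grho x - 1) ∂gm = 0 := by
    rw [integral_sub ri (integrable_const _)]
    have := integral_rho (E := ℝ) (fun _ => 1)
    simp at this
    rw [this]; simp
  obtain ⟨d, B3, md, hd, hld, D3⟩ := poisson hrl (fun x => by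
    unfold grho; rw [cl_of_mem (cl_nonneg x) (cl_le x)]) hrm
  refine ⟨2 * I0, by linarith, fun s => ?_⟩
  have := charfun_conv gm gaussMap gauss_mp gf b (fun x => - e x) d grho gf_meas mb me.neg md mr gf3_int
    (max B (max B2 B3)) (fun x => (hb x).trans (le_max_left _ _))
    (fun x => by rw [abs_neg]; exact (he x).trans ((le_max_left _ _).trans (le_max_right _ _)))
    (fun x => (hd x).trans ((le_max_right _ _).trans (le_max_right _ _))) ri (2 * I0) (by linarith)
    (fun G mG hG => by simpa only [add_zero] using D1 G mG hG)
    (fun G mG hG => by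
      have h := D2 G mG hG
      have e1 : ∀ x, ((-e x - gf x ^ 2 / 2 - gf x * b x : ℝ) : ℂ) * G (gaussMap x)
        = -(((gf x ^ 2 / 2 + gf x * b x + e x : ℝ) : ℂ) * G (gaussMap x)) := by
        intro x; push_cast; ring
      have e2 : ∀ x, ((-e x - 2 * I0 / 2 : ℝ) : ℂ) * G x
        = -(((e x + I0 : ℝ) : ℂ) * G x) := by
        intro x; push_cast; ring
      simp_rw [e1, e2]
      rw [integral_neg, integral_neg, h])
    (fun G mG hG => by rw [D3 G mG hG]; ring) s
  refine this.congr fun n => ?_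
  rw [← integral_rho]
  congr 1

end KnCLT


namespace KnCLT

noncomputable def Phi (c : ℝ) : ℝ := (ProbabilityTheory.gaussianReal 0 1).real (Iic c)

lemma Phi_eq (y : ℝ) : Phi y = (1 / Real.sqrt (2 * Real.pi)) * ∫ t in Set.Iic y, Real.exp (-t ^ 2 / 2) := by
  unfold Phi Measure.real
  rw [ProbabilityTheory.gaussianReal_apply_eq_integral 0 one_ne_zero, ENNReal.toReal_ofReal]
  · unfold ProbabilityTheory.gaussianPDFReal
    rw [integral_const_mul]
    simp
  · exact integral_nonneg fun x => ProbabilityTheory.gaussianPDFReal_nonneg _ _ _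

lemma Phi_neg (y : ℝ) : Phi (-y) = 1 - Phi y := by
  unfold Phi
  haveI := ProbabilityTheory.nullSingletonClass_gaussianReal (μ := 0) (v := 1) one_ne_zero
  have h1 : (ProbabilityTheory.gaussianReal 0 1).real (Ici y) = (ProbabilityTheory.gaussianReal 0 1).real (Iic (-y)) := by
    have := ProbabilityTheory.gaussianReal_map_neg (μ := 0) (v := 1)
    rw [neg_zero] at this
    conv_lhs => rw [← this]
    rw [measureReal_def, Measure.map_apply (by fun_prop) measurableSet_Ici, measureReal_def]
    congr 2
    ext x; simp [le_neg]
  rw [← h1, ← probReal_compl_eq_one_sub measurableSet_Iic, compl_Iic]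
  unfold Measure.real
  rw [measure_congr Ioi_ae_eq_Ici]

lemma Phi_shift (c : ℝ) : (ProbabilityTheory.gaussianReal (-c) 1).real (Iic 0) = Phi c := by
  unfold Phi
  have := ProbabilityTheory.gaussianReal_map_add_const (μ := 0) (v := 1) (-c)
  rw [zero_add] at this
  rw [← this, measureReal_def, Measure.map_apply (by fun_prop) measurableSet_Iic, measureReal_def]
  congr 2
  ext x; simp

lemma bs_meas (n : ℕ) : Measurable (birkhoffSum gaussMap gf n) := by
  unfold birkhoffSum
  have h : ∀ i, Measurable (gaussMap^[i]) := fun i => gauss_meas.iterate i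
  exact Finset.measurable_sum _ fun i _ => gf_meas.comp (h i)

theorem gauss_clt : ∃ v : ℝ, 0 < v ∧ ∀ (m : ℕ → ℕ) (c : ℕ → ℝ) (c0 : ℝ), Tendsto m atTop atTop →
    Tendsto c atTop (nhds c0) →
    Tendsto (fun n => volume.real {x ∈ Ioo (0:ℝ) 1 | birkhoffSum gaussMap gf (m n) x / Real.sqrt (v * m n) ≤ c n})
      atTop (nhds (Phi c0)) := by
  obtain ⟨v, hv, hch⟩ := gauss_charfun
  refine ⟨v, hv, fun m c c0 hm hc => ?_⟩
  haveI : IsProbabilityMeasure (volume.restrict (Ioo (0:ℝ) 1)) := ⟨by simp⟩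
  let X : ℕ → ℝ → ℝ := fun n x => birkhoffSum gaussMap gf (m n) x / Real.sqrt (v * m n) - c n
  have mX : ∀ n, Measurable (X n) := fun n => ((bs_meas (m n)).div_const _).sub_const _
  have hp : ∀ n, IsProbabilityMeasure ((volume.restrict (Ioo (0:ℝ) 1)).map (X n)) := fun n =>
    Measure.isProbabilityMeasure_map (mX n).aemeasurable
  let ν : ℕ → ProbabilityMeasure ℝ := fun n => ⟨(volume.restrict (Ioo (0:ℝ) 1)).map (X n), hp n⟩
  let ν0 : ProbabilityMeasure ℝ := ⟨ProbabilityTheory.gaussianReal (-c0) 1, inferInstance⟩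
  have conv : Tendsto ν atTop (nhds ν0) := by
    rw [ProbabilityMeasure.tendsto_iff_tendsto_charFun]
    intro t
    have e0 : charFun (ν0 : Measure ℝ) t = Complex.exp (-(v * (t / Real.sqrt v) ^ 2 / 2 : ℝ)) *
        Complex.exp (-(t * c0 : ℝ) * Complex.I) := by
      change charFun (ProbabilityTheory.gaussianReal (-c0) 1) t = _
      rw [ProbabilityTheory.charFun_gaussianReal, ← Complex.exp_add]
      congr 1
      rw [div_pow, Real.sq_sqrt hv.le, show v * (t ^ 2 / v) / 2 = t ^ 2 / 2 by field_simp]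
      push_cast; ring
    rw [e0]
    have e1 : ∀ n, charFun (ν n : Measure ℝ) t = (∫ x in Ioo (0:ℝ) 1,
      Complex.exp (Complex.I * (((t / Real.sqrt v) / Real.sqrt (m n) * birkhoffSum gaussMap gf (m n) x : ℝ) : ℂ))) *
        Complex.exp (-(t * c n : ℝ) * Complex.I) := by
      intro n
      change charFun ((volume.restrict (Ioo (0:ℝ) 1)).map (X n)) t = _
      rw [charFun_apply_real, integral_map (mX n).aemeasurable (by fun_prop), ← integral_mul_const]
      congr 1; ext x
      rw [← Complex.exp_add]
      congr 1
      simp only [X]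
      rw [Real.sqrt_mul hv.le]
      push_cast
      ring
    simp_rw [e1]
    refine ((hch (t / Real.sqrt v)).comp hm).mul ?_
    refine (Complex.continuous_exp.tendsto _).comp ?_
    refine Tendsto.mul_const _ ?_
    have := ((hc.const_mul t).neg)
    exact_mod_cast (Complex.continuous_ofReal.tendsto _).comp this
  haveI := ProbabilityTheory.nullSingletonClass_gaussianReal (μ := -c0) (v := 1) one_ne_zero
  have h2 := ProbabilityMeasure.tendsto_measure_of_null_frontier_of_tendsto' conv (E := Iic 0) (by
    rw [frontier_Iic]
    change (ProbabilityTheory.gaussianReal (-c0) 1) {0} = 0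
    simp)
  have h3 := (ENNReal.tendsto_toReal (measure_ne_top _ _)).comp h2
  rw [← Phi_shift]
  refine h3.congr fun n => ?_
  simp only [Function.comp]
  change ((volume.restrict (Ioo (0:ℝ) 1)).map (X n) (Iic 0)).toReal = _
  rw [Measure.map_apply (mX n) measurableSet_Iic, Measure.restrict_apply (mX n measurableSet_Iic), measureReal_def]
  congr 2
  ext x
  simp only [X, mem_inter_iff, mem_preimage, mem_Iic, mem_setOf_eq, sub_nonpos]
  exact and_comm

end KnCLT


namespace KnCLT

noncomputable def pd (m : ℕ) (x : ℝ) : ℝ := ∏ i ∈ Finset.range m, gaussMap^[i] x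

lemma g_mem (x : ℝ) : gaussMap x ∈ Ico (0:ℝ) 1 := by
  unfold gaussMap
  split_ifs
  · simp
  · exact ⟨by linarith [Int.floor_le (1/x)], by linarith [Int.lt_floor_add_one (1/x)]⟩

lemma g_irr {x : ℝ} (hx : Irrational x) : Irrational (gaussMap x) := by
  unfold gaussMap
  rw [if_neg hx.ne_zero, one_div]
  exact hx.inv.sub_intCast _

lemma g_iter_irr {x : ℝ} (hx : Irrational x) (i : ℕ) : Irrational (gaussMap^[i] x) := by
  induction i with
  | zero => exact hx
  | succ i ih => rw [Function.iterate_succ_apply']; exact g_irr ih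

lemma g_iter_mem {x : ℝ} (hx : x ∈ Ico (0:ℝ) 1) (i : ℕ) : gaussMap^[i] x ∈ Ico (0:ℝ) 1 := by
  cases i with
  | zero => exact hx
  | succ i => rw [Function.iterate_succ_apply']; exact g_mem _

lemma g_iter_pos {x : ℝ} (hx : x ∈ Ico (0:ℝ) 1) (hi : Irrational x) (i : ℕ) : gaussMap^[i] x ∈ Ioo (0:ℝ) 1 := by
  have h := g_iter_mem hx i
  exact ⟨lt_of_le_of_ne h.1 (g_iter_irr hi i).ne_zero.symm, h.2⟩

lemma mem_cyl {m : ℕ} {x y : ℝ} : y ∈ cfCyl m x ↔ y ∈ Ico (0:ℝ) 1 ∧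
    ∀ i < m, ⌊1 / gaussMap^[i] y⌋ = ⌊1 / gaussMap^[i] x⌋ := by
  unfold cfCyl cfA
  simp only [mem_setOf_eq, and_congr_right_iff]
  intro _
  constructor
  · intro h i hi
    have := h (i+1) (by omega) (by omega)
    simpa using this
  · intro h i h1 h2
    exact h (i-1) (by omega)

lemma cyl_succ {m : ℕ} {x y : ℝ} : y ∈ cfCyl (m+1) x ↔ y ∈ cfCyl m x ∧
    ⌊1 / gaussMap^[m] y⌋ = ⌊1 / gaussMap^[m] x⌋ := by
  rw [mem_cyl, mem_cyl, and_assoc]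
  refine and_congr_right fun _ => ?_
  constructor
  · exact fun h => ⟨fun i hi => h i (by omega), h m (by omega)⟩
  · rintro ⟨h1, h2⟩ i hi
    rcases Nat.lt_succ_iff_lt_or_eq.1 hi with h | rfl
    · exact h1 i h
    · exact h2

lemma cyl_anti {m m' : ℕ} (h : m ≤ m') (x : ℝ) : cfCyl m' x ⊆ cfCyl m x := by
  intro y hy
  rw [mem_cyl] at hy ⊢
  exact ⟨hy.1, fun i hi => hy.2 i (by omega)⟩

lemma fl_pos {t : ℝ} (ht : t ∈ Ioo (0:ℝ) 1) : 1 ≤ ⌊1 / t⌋ := by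
  rw [Int.le_floor]; push_cast; rw [le_div_iff₀ ht.1]; linarith [ht.2]

/-- basic identity for one step -/
lemma step_eq {t : ℝ} (h : ⌊1 / t⌋ ≠ 0) : t * (⌊1 / t⌋ + gaussMap t) = 1 ∧ t ≠ 0 := by
  have ht : t ≠ 0 := by rintro rfl; simp at h
  refine ⟨?_, ht⟩
  unfold gaussMap
  rw [if_neg ht]
  field_simp
  ring

lemma pd_succ (m : ℕ) (x : ℝ) : pd (m+1) x = pd m x * gaussMap^[m] x := by
  unfold pd; rw [Finset.prod_range_succ]

lemma pd_ab {x : ℝ} (hx : x ∈ Ico (0:ℝ) 1) (hi : Irrational x) (m : ℕ) :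
    ∃ A B : ℝ, 0 < A ∧ 0 ≤ B ∧ B ≤ A ∧ ∀ y ∈ cfCyl m x, pd m y * (A + B * gaussMap^[m] y) = 1 := by
  induction m with
  | zero => exact ⟨1, 0, one_pos, le_rfl, zero_le_one, fun y _ => by simp [pd]⟩
  | succ m ih =>
    obtain ⟨A, B, hA, hB, hBA, h⟩ := ih
    have ha := fl_pos (g_iter_pos hx hi m)
    set a := ⌊1 / gaussMap^[m] x⌋ with haa
    have ha' : (1:ℝ) ≤ a := by exact_mod_cast ha
    refine ⟨A * a + B, A, by positivity, hA.le, by nlinarith, fun y hy => ?_⟩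
    rw [cyl_succ] at hy
    have h1 := h y hy.1
    obtain ⟨h2, h3⟩ := step_eq (t := gaussMap^[m] y) (by rw [hy.2]; omega)
    rw [hy.2, ← haa] at h2
    rw [pd_succ, Function.iterate_succ_apply']
    set t := gaussMap^[m] y
    have : pd m y * t * (A * a + B + A * gaussMap t) = pd m y * (A * (t * (a + gaussMap t)) + B * t) := by ring
    rw [this, h2, mul_one, h1]

lemma self_mem_cyl {x : ℝ} (hx : x ∈ Ico (0:ℝ) 1) (m : ℕ) : x ∈ cfCyl m x := by
  rw [mem_cyl]; exact ⟨hx, fun _ _ => rfl⟩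

lemma pd_nonneg {y : ℝ} (hy : y ∈ Ico (0:ℝ) 1) (m : ℕ) : 0 ≤ pd m y :=
  Finset.prod_nonneg fun i _ => (g_iter_mem hy i).1

lemma pd_pos {y : ℝ} (hy : y ∈ Ico (0:ℝ) 1) (hi : Irrational y) (m : ℕ) : 0 < pd m y :=
  Finset.prod_pos fun i _ => (g_iter_pos hy hi i).1

lemma pd_cmp {x : ℝ} (hx : x ∈ Ico (0:ℝ) 1) (hi : Irrational x) (m : ℕ) {y z : ℝ} (hy : y ∈ cfCyl m x)
    (hz : z ∈ cfCyl m x) : pd m y ≤ 2 * pd m z := by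
  obtain ⟨A, B, hA, hB, hBA, h⟩ := pd_ab hx hi m
  have h1 := h y hy
  have h2 := h z hz
  have my := g_iter_mem (mem_cyl.1 hy).1 m
  have mz := g_iter_mem (mem_cyl.1 hz).1 m
  have py := pd_nonneg (mem_cyl.1 hy).1 m
  have pz := pd_nonneg (mem_cyl.1 hz).1 m
  set s := gaussMap^[m] y
  set t := gaussMap^[m] z
  have k1 : pd m y * A ≤ 1 := by
    have : 0 ≤ pd m y * (B * s) := mul_nonneg py (mul_nonneg hB my.1)
    nlinarith
  have k2 : 1 ≤ pd m z * (2 * A) := by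
    have : B * t ≤ A := by nlinarith [mz.1, mz.2]
    nlinarith
  by_contra! hc
  nlinarith

lemma diff_eq {x : ℝ} (hx : x ∈ Ico (0:ℝ) 1) (hi : Irrational x) (m : ℕ) {y : ℝ} (hy : y ∈ cfCyl m x) :
    |x - y| = pd m x * pd m y * |gaussMap^[m] x - gaussMap^[m] y| := by
  induction m with
  | zero => simp [pd]
  | succ m ih =>
    rw [cyl_succ] at hy
    rw [ih hy.1, pd_succ, pd_succ, Function.iterate_succ_apply', Function.iterate_succ_apply']
    have ha := fl_pos (g_iter_pos hx hi m)
    obtain ⟨h1, h1'⟩ := step_eq (t := gaussMap^[m] x) (by omega)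
    obtain ⟨h2, h2'⟩ := step_eq (t := gaussMap^[m] y) (by rw [hy.2]; omega)
    have p1 := (g_iter_mem hx m).1
    have p2 := (g_iter_mem (mem_cyl.1 hy.1).1 m).1
    rw [hy.2] at h2
    set s := gaussMap^[m] x
    set t := gaussMap^[m] y
    have : s - t = -(s * t * (gaussMap s - gaussMap t)) := by linear_combination t * h1 - s * h2
    rw [this, abs_neg, abs_mul, abs_mul, abs_of_nonneg p1, abs_of_nonneg p2]
    ring

lemma cyl_U {x : ℝ} (hx : x ∈ Ico (0:ℝ) 1) (hi : Irrational x) (m : ℕ) {y : ℝ} (hy : y ∈ cfCyl m x) :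
    |x - y| ≤ 2 * pd m x ^ 2 := by
  rw [diff_eq hx hi m hy]
  have h1 := pd_cmp hx hi m hy (self_mem_cyl hx m)
  have h2 := pd_nonneg hx m
  have h4 := pd_nonneg (mem_cyl.1 hy).1 m
  have a1 := g_iter_mem hx m
  have a2 := g_iter_mem (mem_cyl.1 hy).1 m
  have h3 : |gaussMap^[m] x - gaussMap^[m] y| ≤ 1 := by
    rw [abs_le]; constructor <;> linarith [a1.1, a1.2, a2.1, a2.2]
  calc pd m x * pd m y * |gaussMap^[m] x - gaussMap^[m] y| ≤ pd m x * pd m y * 1 :=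
        mul_le_mul_of_nonneg_left h3 (mul_nonneg h2 h4)
    _ ≤ _ := by nlinarith

lemma cyl_L {x : ℝ} (hx : x ∈ Ico (0:ℝ) 1) (hi : Irrational x) (m : ℕ) {y : ℝ}
    (hy : |x - y| < 1 / 4 * min (gaussMap^[m] x) (1 - gaussMap^[m] x) * pd m x ^ 2) : y ∈ cfCyl m x := by
  induction m with
  | zero =>
    rw [mem_cyl]
    refine ⟨?_, fun i hi => by omega⟩
    simp only [pd, Finset.range_zero, Finset.prod_empty, Function.iterate_zero, id, one_pow, mul_one] at hy
    have h1 := min_le_left x (1 - x)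
    have h2 := min_le_right x (1 - x)
    rw [abs_lt] at hy
    have := hx.1
    have := hx.2
    constructor <;> linarith
  | succ m ih =>
    have ht := g_iter_pos hx hi m
    have ht' := g_iter_pos hx hi (m+1)
    rw [pd_succ] at hy
    rw [Function.iterate_succ_apply'] at hy ht'
    have ha := fl_pos ht
    obtain ⟨h1, h1'⟩ := step_eq (t := gaussMap^[m] x) (by omega)
    have pp := pd_pos hx hi m
    set t := gaussMap^[m] x with htt
    set t' := gaussMap t with htt'
    set a := ⌊1 / t⌋ with haa
    have ha' : (1:ℝ) ≤ a := by exact_mod_cast ha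
    set μ := min t' (1 - t') with hμ
    have m1 : μ ≤ t' := min_le_left _ _
    have m2 : μ ≤ 1 - t' := min_le_right _ _
    have m0 : 0 < μ := lt_min ht'.1 (by linarith [ht'.2])
    have hmono : μ * t ^ 2 ≤ min t (1 - t) := by
      refine le_min ?_ ?_
      · nlinarith [ht.1, ht.2, ht'.2]
      · have : 1 - t = (a - 1 + t') * t := by linear_combination -h1
        rw [this]
        have q1 : μ * t ^ 2 ≤ t' * t := by nlinarith [ht.1, ht.2, mul_pos m0 ht.1]
        nlinarith [ht.1]
    have hm : y ∈ cfCyl m x := by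
      apply ih
      refine hy.trans_le ?_
      nlinarith [sq_nonneg (pd m x)]
    rw [cyl_succ]
    refine ⟨hm, ?_⟩
    have hd := diff_eq hx hi m hm
    have hc := pd_cmp hx hi m (self_mem_cyl hx m) hm
    have mw := g_iter_mem (mem_cyl.1 hm).1 m
    rw [← htt] at hd
    set w := gaussMap^[m] y
    have hw : |t - w| < 1 / 2 * μ * t ^ 2 := by
      have q : pd m x * (pd m x / 2) * |t - w| ≤ |x - y| := by
        rw [hd]
        refine mul_le_mul_of_nonneg_right ?_ (abs_nonneg _)
        exact mul_le_mul_of_nonneg_left (by linarith) pp.le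
      by_contra! hcon
      have q2 : pd m x * (pd m x / 2) * (1 / 2 * μ * t ^ 2) ≤ pd m x * (pd m x / 2) * |t - w| :=
        mul_le_mul_of_nonneg_left hcon (by positivity)
      nlinarith
    rw [abs_lt] at hw
    have htp := ht.1
    have e1 : t * a = 1 - t * t' := by linear_combination h1
    have ap : 0 < a * t := by positivity
    have ta : a * t ≤ 1 := by nlinarith [mul_pos htp ht'.1]
    have w1 : w * a ≤ 1 := by
      have q : w < t + 1 / 2 * t' * t ^ 2 := by nlinarith [sq_nonneg t]
      have q2 : w * a < (t + 1 / 2 * t' * t ^ 2) * a := mul_lt_mul_of_pos_right q (by linarith)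
      have q3 : (t + 1 / 2 * t' * t ^ 2) * a = t * a + 1 / 2 * (t' * t) * (a * t) := by ring
      have q4 : 1 / 2 * (t' * t) * (a * t) ≤ 1 / 2 * (t' * t) * 1 :=
        mul_le_mul_of_nonneg_left ta (by have := ht'.1; positivity)
      nlinarith [mul_pos ht'.1 htp]
    have w2 : 1 < w * (a + 1) := by
      have q : t - 1 / 2 * (1 - t') * t ^ 2 < w := by nlinarith [sq_nonneg t]
      have q2 : (t - 1 / 2 * (1 - t') * t ^ 2) * (a + 1) < w * (a + 1) :=
        mul_lt_mul_of_pos_right q (by linarith)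
      have q3 : (t - 1 / 2 * (1 - t') * t ^ 2) * (a + 1) = t * a + t - 1 / 2 * ((1 - t') * t) * (t * (a + 1)) := by ring
      have q5 : t * (a + 1) ≤ 2 := by nlinarith
      have q4 : 1 / 2 * ((1 - t') * t) * (t * (a + 1)) ≤ 1 / 2 * ((1 - t') * t) * 2 :=
        mul_le_mul_of_nonneg_left q5 (by have : 0 < 1 - t' := by linarith [ht'.2]
                                         positivity)
      nlinarith
    have wp : 0 < w := by
      by_contra! hcon
      nlinarith
    rw [Int.floor_eq_iff]
    constructor
    · rw [le_div_iff₀ wp]; linarith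
    · rw [div_lt_iff₀ wp]; linarith

lemma pd_half {x : ℝ} (hx : x ∈ Ico (0:ℝ) 1) (hi : Irrational x) (m : ℕ) : pd (2 * m) x ≤ (1/2) ^ m := by
  induction m with
  | zero => simp [pd]
  | succ m ih =>
    rw [show 2 * (m + 1) = 2 * m + 1 + 1 by ring, pd_succ, pd_succ, mul_assoc, pow_succ]
    have ht := g_iter_pos hx hi (2*m)
    have ht' := g_iter_pos hx hi (2*m+1)
    refine mul_le_mul ih ?_ (mul_nonneg ht.1.le ht'.1.le) (by positivity)
    rw [Function.iterate_succ_apply'] at ht' ⊢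
    have ha := fl_pos ht
    obtain ⟨h1, h1'⟩ := step_eq (t := gaussMap^[2*m] x) (by omega)
    have ha' : (1:ℝ) ≤ (⌊1 / gaussMap^[2*m] x⌋ : ℝ) := by exact_mod_cast ha
    nlinarith [ht.1, ht.2, ht'.1, ht'.2]

lemma pd_anti {x : ℝ} (hx : x ∈ Ico (0:ℝ) 1) {m m' : ℕ} (h : m ≤ m') : pd m' x ≤ pd m x := by
  induction m', h using Nat.le_induction with
  | base => exact le_rfl
  | succ k _ ih =>
    rw [pd_succ]
    have := g_iter_mem hx k
    have := pd_nonneg hx k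
    nlinarith [(g_iter_mem hx k).1, (g_iter_mem hx k).2]

end KnCLT


namespace KnCLT

lemma bT_mem (β x : ℝ) : betaT β x ∈ Ico (0:ℝ) 1 := by
  unfold betaT
  constructor
  · linarith [Int.floor_le (β * x)]
  · linarith [Int.lt_floor_add_one (β * x)]

lemma bT_iter_mem {β x : ℝ} (hx : x ∈ Ico (0:ℝ) 1) (n : ℕ) : (betaT β)^[n] x ∈ Ico (0:ℝ) 1 := by
  cases n with
  | zero => simpa
  | succ n => rw [Function.iterate_succ_apply']; exact bT_mem _ _

lemma mem_bcyl {β : ℝ} {n : ℕ} {x y : ℝ} : y ∈ betaCyl β n x ↔ y ∈ Ico (0:ℝ) 1 ∧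
    ∀ i < n, ⌊β * (betaT β)^[i] y⌋ = ⌊β * (betaT β)^[i] x⌋ := by
  unfold betaCyl betaEps
  simp only [mem_setOf_eq]
  refine and_congr_right fun _ => ⟨fun h i hi => ?_, fun h i h1 h2 => h (i-1) (by omega)⟩
  have := h (i+1) (by omega) (by omega)
  simpa using this

lemma bdiff {β : ℝ} {n : ℕ} {x y : ℝ} (h : ∀ i < n, ⌊β * (betaT β)^[i] y⌋ = ⌊β * (betaT β)^[i] x⌋) :
    β ^ n * (x - y) = (betaT β)^[n] x - (betaT β)^[n] y := by
  induction n with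
  | zero => simp
  | succ n ih =>
    have h1 := ih fun i hi => h i (by omega)
    have h2 := h n (by omega)
    rw [Function.iterate_succ_apply', Function.iterate_succ_apply']
    set s := (betaT β)^[n] x
    set t := (betaT β)^[n] y
    unfold betaT
    rw [h2, pow_succ]
    linear_combination β * h1

lemma bcyl_U {β : ℝ} (hβ : 1 < β) {n : ℕ} {x y : ℝ} (hx : x ∈ Ico (0:ℝ) 1) (hy : y ∈ betaCyl β n x) :
    |x - y| < (β ^ n)⁻¹ := by
  obtain ⟨hy, h⟩ := mem_bcyl.1 hy
  have h1 := bdiff h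
  have a := bT_iter_mem (β := β) hx n
  have b := bT_iter_mem (β := β) hy n
  have hp : 0 < β ^ n := by positivity
  have hab : |β ^ n * (x - y)| = β ^ n * |x - y| := by rw [abs_mul, abs_of_pos hp]
  rw [← one_div, lt_div_iff₀ hp, mul_comm, ← hab, h1, abs_lt]
  constructor <;> linarith [a.1, a.2, b.1, b.2]

lemma bleft {β : ℝ} (hβ : 1 < β) (n : ℕ) : ∀ x ∈ Ico (0:ℝ) 1, ∀ r, 0 ≤ r → r ≤ (betaT β)^[n] x →
    x - r / β ^ n ∈ Ico (0:ℝ) 1 ∧ (∀ i < n, ⌊β * (betaT β)^[i] (x - r / β ^ n)⌋ = ⌊β * (betaT β)^[i] x⌋) ∧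
    (betaT β)^[n] (x - r / β ^ n) = (betaT β)^[n] x - r := by
  induction n with
  | zero =>
    intro x hx r h0 hr
    simp only [Function.iterate_zero, id] at hr
    simp only [pow_zero, div_one]
    refine ⟨⟨by linarith, by linarith [hx.2]⟩, by simp, by simp⟩
  | succ n ih =>
    intro x hx r h0 hr
    rw [Function.iterate_succ_apply] at hr
    obtain ⟨h1, h2, h3⟩ := ih (betaT β x) (bT_mem _ _) r h0 hr
    have hb : 0 < β := by linarith
    have hn : 0 ≤ r / β ^ n := by positivity
    have e : β * (x - r / β ^ (n+1)) = (⌊β * x⌋ : ℝ) + (betaT β x - r / β ^ n) := by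
      unfold betaT; rw [pow_succ]; field_simp; ring
    have f : ⌊β * (x - r / β ^ (n+1))⌋ = ⌊β * x⌋ := by
      rw [e, Int.floor_intCast_add, Int.floor_eq_zero_iff.2 h1, add_zero]
    have g : betaT β (x - r / β ^ (n+1)) = betaT β x - r / β ^ n := by
      conv_lhs => unfold betaT
      rw [f, e]; ring
    refine ⟨⟨?_, ?_⟩, ?_, ?_⟩
    · have : 0 ≤ β * (x - r / β ^ (n+1)) := by
        rw [e]
        have : (0:ℝ) ≤ ⌊β * x⌋ := by exact_mod_cast Int.floor_nonneg.2 (mul_nonneg hb.le hx.1)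
        linarith [h1.1]
      exact nonneg_of_mul_nonneg_right this hb
    · have : 0 ≤ r / β ^ (n+1) := by positivity
      linarith [hx.2]
    · intro i hi
      cases i with
      | zero => simpa using f
      | succ i =>
        rw [Function.iterate_succ_apply, Function.iterate_succ_apply, g]
        exact h2 i (by omega)
    · rw [Function.iterate_succ_apply, Function.iterate_succ_apply, g, h3]

lemma bT_zero (β : ℝ) (n : ℕ) : (betaT β)^[n] 0 = 0 :=
  Function.iterate_fixed (by simp [betaT]) n

lemma bsep {β : ℝ} (hβ : 1 < β) (j : ℕ) : ∀ z z', 0 ≤ z → z < z' → (betaT β)^[j+1] z = 0 →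
    (betaT β)^[j+1] z' = 0 → (betaT β)^[j] z' ≠ 0 → 1 ≤ β ^ (j+1) * (z' - z) := by
  induction j with
  | zero =>
    intro z z' h0 hz h1 h2 _
    simp only [zero_add, Function.iterate_one] at h1 h2
    unfold betaT at h1 h2
    have : (⌊β * z⌋:ℝ) < ⌊β * z'⌋ := by nlinarith
    have : (⌊β * z⌋:ℝ) + 1 ≤ ⌊β * z'⌋ := by exact_mod_cast this
    rw [zero_add, pow_one]; linarith
  | succ j ih =>
    intro z z' h0 hz h1 h2 h3
    rw [Function.iterate_succ_apply] at h1 h2 h3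
    have m1 := bT_mem β z
    have m2 := bT_mem β z'
    have e1 : β * z = ⌊β * z⌋ + betaT β z := by unfold betaT; ring
    have e2 : β * z' = ⌊β * z'⌋ + betaT β z' := by unfold betaT; ring
    have hle : ⌊β * z⌋ ≤ ⌊β * z'⌋ := Int.floor_le_floor (by nlinarith)
    have hp : 0 < β ^ (j+1) := by positivity
    have e3 : β ^ (j+1+1) * (z' - z) = β ^ (j+1) * ((⌊β * z'⌋ - ⌊β * z⌋) + (betaT β z' - betaT β z)) := by
      rw [pow_succ β (j+1)]; linear_combination β ^ (j+1) * (e2 - e1)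
    rw [e3]
    rcases hle.eq_or_lt with h | h
    · rw [h, sub_self, zero_add]
      refine ih _ _ m1.1 ?_ h1 h2 h3
      rw [h] at e1
      nlinarith
    · have hp2 : 0 < betaT β z' := by
        rcases m2.1.eq_or_lt with h' | h'
        · rw [← h', bT_zero] at h3; exact absurd rfl h3
        · exact h'
      have := ih 0 _ le_rfl hp2 (bT_zero _ _) h2 h3
      rw [sub_zero] at this
      refine this.trans (mul_le_mul_of_nonneg_left ?_ hp.le)
      have : (⌊β * z⌋:ℝ) + 1 ≤ ⌊β * z'⌋ := by exact_mod_cast h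
      linarith [m1.2]

def bW (β : ℝ) (j : ℕ) : Set ℝ := {z | z ∈ Ico (0:ℝ) 1 ∧ (betaT β)^[j+1] z = 0 ∧ (betaT β)^[j] z ≠ 0}

lemma bW_disj {β : ℝ} (hβ : 1 < β) (j : ℕ) :
    (bW β j).PairwiseDisjoint (fun z => Ico (z - (β ^ (j+1))⁻¹) z) := by
  have key : ∀ z ∈ bW β j, ∀ z' ∈ bW β j, z < z' → Disjoint (Ico (z - (β ^ (j+1))⁻¹) z) (Ico (z' - (β ^ (j+1))⁻¹) z') := by
    intro z hz z' hz' h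
    have := bsep hβ j z z' hz.1.1 h hz.2.1 hz'.2.1 hz'.2.2
    have hp : 0 < β ^ (j+1) := by positivity
    rw [mul_comm, ← inv_le_iff_one_le_mul₀ hp] at this
    rw [Set.disjoint_left]
    intro t ht ht'
    linarith [ht.2, ht'.1]
  intro z hz z' hz' hne
  rcases lt_or_gt_of_ne hne with h | h
  · exact key z hz z' hz' h
  · exact (key z' hz' z hz h).symm

lemma bW_count {β : ℝ} (hβ : 1 < β) (j : ℕ) : (bW β j).Countable := by
  refine Set.PairwiseDisjoint.countable_of_nonempty_interior (bW_disj hβ j) fun z _ => ?_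
  rw [interior_Ico, nonempty_Ioo]
  have : 0 < (β ^ (j+1))⁻¹ := by positivity
  linarith

lemma bW_meas {β : ℝ} (hβ : 1 < β) (j : ℕ) (c : ℝ) (hc : 0 ≤ c) :
    volume (⋃ z ∈ bW β j, Ico z (z + c)) ≤ ENNReal.ofReal (c * β ^ (j+1)) := by
  have hp : 0 < β ^ (j+1) := by positivity
  have hq : 0 < (β ^ (j+1))⁻¹ := by positivity
  have h1 : ∑' z : bW β j, ENNReal.ofReal ((β ^ (j+1))⁻¹) ≤ 1 := by
    have e : ∑' z : bW β j, ENNReal.ofReal ((β ^ (j+1))⁻¹) = volume (⋃ z ∈ bW β j, Ico (z - (β ^ (j+1))⁻¹) z) := by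
      rw [measure_biUnion (bW_count hβ j) (bW_disj hβ j) fun _ _ => measurableSet_Ico]
      simp
    rw [e]
    calc _ ≤ volume (Ico (0:ℝ) 1) := by
          refine measure_mono (iUnion₂_subset fun z hz => ?_)
          have hz0 : 0 < z := hz.1.1.lt_of_ne (by rintro rfl; exact hz.2.2 (bT_zero _ _))
          have := bsep hβ j 0 z le_rfl hz0 (bT_zero _ _) hz.2.1 hz.2.2
          rw [mul_comm, ← inv_le_iff_one_le_mul₀ hp] at this
          exact fun t ht => ⟨by linarith [ht.1], by linarith [ht.2, hz.1.2]⟩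
      _ = 1 := by simp
  calc _ ≤ ∑' z : bW β j, volume (Ico (z:ℝ) (z + c)) := measure_biUnion_le _ (bW_count hβ j) _
    _ = ∑' z : bW β j, ENNReal.ofReal (c * β ^ (j+1)) * ENNReal.ofReal ((β ^ (j+1))⁻¹) := by
        refine tsum_congr fun z => ?_
        rw [Real.volume_Ico, ← ENNReal.ofReal_mul (by positivity)]
        congr 1; field_simp; ring
    _ = ENNReal.ofReal (c * β ^ (j+1)) * ∑' z : bW β j, ENNReal.ofReal ((β ^ (j+1))⁻¹) := ENNReal.tsum_mul_left
    _ ≤ _ := mul_le_of_le_one_right' h1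

lemma first_zero {β z : ℝ} (n : ℕ) (hz : z ∈ Ico (0:ℝ) 1) (h : (betaT β)^[n] z = 0) :
    z = 0 ∨ ∃ j < n, z ∈ bW β j := by
  induction n with
  | zero => left; simpa using h
  | succ n ih =>
    by_cases h0 : (betaT β)^[n] z = 0
    · rcases ih h0 with h | ⟨j, hj, h⟩
      · exact Or.inl h
      · exact Or.inr ⟨j, by omega, h⟩
    · exact Or.inr ⟨n, by omega, hz, h, h0⟩

lemma geo {β : ℝ} (hβ : 1 < β) (n : ℕ) : 1 + ∑ j ∈ Finset.range n, β ^ (j+1) ≤ β / (β - 1) * β ^ n := by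
  have hb : 0 < β - 1 := by linarith
  induction n with
  | zero => simp; rw [le_div_iff₀ hb]; linarith
  | succ n ih =>
    rw [Finset.sum_range_succ, ← add_assoc]
    have : β / (β - 1) * β ^ (n+1) = β / (β - 1) * β ^ n + β ^ (n+1) := by
      field_simp; ring
    linarith

theorem beta_meas {β : ℝ} (hβ : 1 < β) (n : ℕ) (δ : ℝ) (hδ : 0 ≤ δ) :
    volume {x ∈ Ico (0:ℝ) 1 | (betaT β)^[n] x < δ} ≤ ENNReal.ofReal (β / (β - 1) * δ) := by
  have hp : 0 < β ^ n := by positivity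
  have hsub : {x ∈ Ico (0:ℝ) 1 | (betaT β)^[n] x < δ} ⊆
      Ico 0 (0 + δ / β ^ n) ∪ ⋃ j ∈ Finset.range n, ⋃ z ∈ bW β j, Ico z (z + δ / β ^ n) := by
    intro x hx
    obtain ⟨h1, h2, h3⟩ := bleft hβ n x hx.1 _ (bT_iter_mem hx.1 n).1 le_rfl
    rw [sub_self] at h3
    set z := x - (betaT β)^[n] x / β ^ n with hz
    have hm : x ∈ Ico z (z + δ / β ^ n) := by
      have : 0 ≤ (betaT β)^[n] x / β ^ n := div_nonneg (bT_iter_mem hx.1 n).1 hp.le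
      have : (betaT β)^[n] x / β ^ n < δ / β ^ n := by gcongr; exact hx.2
      constructor <;> linarith
    rcases first_zero n h1 h3 with h | ⟨j, hj, h⟩
    · left; rwa [h] at hm
    · right
      simp only [mem_iUnion, Finset.mem_range]
      exact ⟨j, hj, z, h, hm⟩
  calc _ ≤ _ := measure_mono hsub
    _ ≤ volume (Ico 0 (0 + δ / β ^ n)) + volume (⋃ j ∈ Finset.range n, ⋃ z ∈ bW β j, Ico z (z + δ / β ^ n)) :=
        measure_union_le _ _
    _ ≤ ENNReal.ofReal (δ / β ^ n) + ∑ j ∈ Finset.range n, ENNReal.ofReal (δ / β ^ n * β ^ (j+1)) := by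
        gcongr
        · simp
        · refine (measure_biUnion_finset_le _ _).trans (Finset.sum_le_sum fun j _ => ?_)
          exact bW_meas hβ j _ (by positivity)
    _ = ENNReal.ofReal (δ / β ^ n * (1 + ∑ j ∈ Finset.range n, β ^ (j+1))) := by
        rw [← ENNReal.ofReal_sum_of_nonneg (fun _ _ => by positivity), ← ENNReal.ofReal_add (by positivity)
          (Finset.sum_nonneg fun _ _ => by positivity), mul_add, mul_one, Finset.mul_sum]
    _ ≤ _ := by
        apply ENNReal.ofReal_le_ofReal
        calc _ ≤ δ / β ^ n * (β / (β - 1) * β ^ n) := mul_le_mul_of_nonneg_left (geo hβ n) (by positivity)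
          _ = _ := by field_simp

end KnCLT


namespace KnCLT

lemma gauss_min (m : ℕ) (δ : ℝ) (hδ : 0 ≤ δ) :
    volume {x ∈ Ioo (0:ℝ) 1 | min (gaussMap^[m] x) (1 - gaussMap^[m] x) < δ} ≤ ENNReal.ofReal (4 * δ) := by
  set B : Set ℝ := {t | min t (1 - t) < δ} with hB
  have mB : MeasurableSet B := measurableSet_lt (by fun_prop) measurable_const
  have mT : Measurable (gaussMap^[m]) := gauss_meas.iterate m
  have h2 := log2_pos
  set A : Set ℝ := gaussMap^[m] ⁻¹' B with hA
  have mA : MeasurableSet A := mT mB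
  have e : {x ∈ Ioo (0:ℝ) 1 | min (gaussMap^[m] x) (1 - gaussMap^[m] x) < δ} = A ∩ Ioo 0 1 := by
    ext x; simp [hA, hB, and_comm]
  have hinv : gm A = gm B := (gauss_mp.iterate m).measure_preimage mB.nullMeasurableSet
  have up : ∀ S, MeasurableSet S → gm S ≤ ENNReal.ofReal (1 / Real.log 2) * volume (S ∩ Ioo 0 1) := by
    intro S hS
    unfold gm
    rw [withDensity_apply _ hS, Measure.restrict_restrict hS, ← setLIntegral_const]
    exact setLIntegral_mono' (hS.inter measurableSet_Ioo) fun x hx => ENNReal.ofReal_le_ofReal (gw_le hx.2.1.le)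
  have lo : ∀ S, MeasurableSet S → ENNReal.ofReal (1 / (2 * Real.log 2)) * volume (S ∩ Ioo 0 1) ≤ gm S := by
    intro S hS
    unfold gm
    rw [withDensity_apply _ hS, Measure.restrict_restrict hS, ← setLIntegral_const]
    refine setLIntegral_mono' (hS.inter measurableSet_Ioo) fun x hx => ENNReal.ofReal_le_ofReal ?_
    unfold gw
    apply one_div_le_one_div_of_le
    · have := hx.2.1; positivity
    · nlinarith [hx.2.2]
  have hBv : volume (B ∩ Ioo 0 1) ≤ ENNReal.ofReal (2 * δ) := by
    calc _ ≤ volume (Ioo 0 δ ∪ Ioo (1 - δ) 1) := by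
          refine measure_mono fun t ht => ?_
          have ht1 : min t (1 - t) < δ := ht.1
          rcases min_lt_iff.1 ht1 with h | h
          · left; exact ⟨ht.2.1, h⟩
          · right; exact ⟨by linarith, ht.2.2⟩
      _ ≤ _ := measure_union_le _ _
      _ = _ := by
        rw [Real.volume_Ioo, Real.volume_Ioo, ← ENNReal.ofReal_add (by linarith) (by linarith)]
        congr 1; ring
  rw [e]
  have one : ENNReal.ofReal (2 * Real.log 2) * ENNReal.ofReal (1 / (2 * Real.log 2)) = 1 := by
    rw [← ENNReal.ofReal_mul (by positivity)]
    rw [mul_one_div_cancel (by positivity)]; simp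
  calc volume (A ∩ Ioo 0 1) = ENNReal.ofReal (2 * Real.log 2) * (ENNReal.ofReal (1 / (2 * Real.log 2)) * volume (A ∩ Ioo 0 1)) := by
        rw [← mul_assoc, one, one_mul]
    _ ≤ ENNReal.ofReal (2 * Real.log 2) * (ENNReal.ofReal (1 / Real.log 2) * ENNReal.ofReal (2 * δ)) := by
        refine mul_le_mul_right ((lo A mA).trans ?_) _
        rw [hinv]
        exact (up B mB).trans (mul_le_mul_right hBv _)
    _ = _ := by
        rw [← ENNReal.ofReal_mul (by positivity), ← ENNReal.ofReal_mul (by positivity)]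
        congr 1; field_simp; ring

lemma bs_eq {x : ℝ} (hx : x ∈ Ico (0:ℝ) 1) (hi : Irrational x) (m : ℕ) :
    birkhoffSum gaussMap gf m x = -Real.log (pd m x) - m * kap := by
  unfold birkhoffSum pd gf
  rw [Real.log_prod (fun i _ => (g_iter_pos hx hi i).1.ne'), Finset.sum_sub_distrib]
  simp

section
variable {β : ℝ} (hβ : 1 < β) {n : ℕ} {x δ : ℝ} (hx : x ∈ Ico (0:ℝ) 1) (hi : Irrational x)

include hβ hx hi

lemma M_up (hD : δ ≤ (betaT β)^[n] x) {m : ℕ} (hm : betaCyl β n x ⊆ cfCyl m x) :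
    δ / β ^ n ≤ 2 * pd m x ^ 2 := by
  have hp : 0 < β ^ n := by positivity
  have hD0 := (bT_iter_mem (β := β) hx n).1
  obtain ⟨h1, h2, _⟩ := bleft hβ n x hx _ hD0 le_rfl
  have := cyl_U hx hi m (hm (mem_bcyl.2 ⟨h1, h2⟩))
  rw [sub_sub_cancel, abs_of_nonneg (by positivity)] at this
  refine le_trans ?_ this
  gcongr

lemma M_bdd (hδ : 0 < δ) (hD : δ ≤ (betaT β)^[n] x) : BddAbove {m | betaCyl β n x ⊆ cfCyl m x} := by
  have hp : 0 < β ^ n := by positivity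
  obtain ⟨N, hN⟩ := exists_pow_lt_of_lt_one (show 0 < δ / β ^ n / 2 by positivity) (show (1/2:ℝ) < 1 by norm_num)
  refine ⟨2 * N, fun m hm => ?_⟩
  by_contra! hc
  have h1 := M_up hβ hx hi hD hm
  have h2 := (pd_anti hx hc.le).trans (pd_half hx hi N)
  have h3 := pd_nonneg hx m
  have h4 : pd m x ≤ 1 := by
    have := pd_anti hx (Nat.zero_le m); simpa [pd] using this
  nlinarith

lemma k_up (hδ : 0 < δ) (hD : δ ≤ (betaT β)^[n] x) {m : ℕ} (hm : m ≤ kCF β n x) :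
    δ / β ^ n ≤ 2 * pd m x ^ 2 := by
  refine M_up hβ hx hi hD ?_
  have : kCF β n x ∈ {m | betaCyl β n x ⊆ cfCyl m x} := by
    refine Nat.sSup_mem ⟨0, fun y hy => ?_⟩ (M_bdd hβ hx hi hδ hD)
    rw [mem_cyl]; exact ⟨(mem_bcyl.1 hy).1, by simp⟩
  exact Subset.trans this (cyl_anti hm x)

lemma k_lo (hδ : 0 < δ) (hD : δ ≤ (betaT β)^[n] x) {m : ℕ}
    (hmin : δ ≤ min (gaussMap^[m] x) (1 - gaussMap^[m] x)) (hm : (β ^ n)⁻¹ ≤ 1 / 4 * δ * pd m x ^ 2) :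
    m ≤ kCF β n x := by
  refine le_csSup (M_bdd hβ hx hi hδ hD) fun y hy => ?_
  refine cyl_L hx hi m ?_
  calc _ < _ := bcyl_U hβ hx hy
    _ ≤ _ := hm
    _ ≤ _ := by gcongr

lemma k_up' (hδ : 0 < δ) (hD : δ ≤ (betaT β)^[n] x) {m : ℕ} (hm : m ≤ kCF β n x) :
    birkhoffSum gaussMap gf m x ≤ n * Real.log β / 2 + Real.log (2 / δ) / 2 - m * kap := by
  have h := k_up hβ hx hi hδ hD hm
  have hp : 0 < β ^ n := by positivity
  have hq := pd_pos hx hi m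
  have h' := Real.log_le_log (by positivity) h
  rw [Real.log_div hδ.ne' hp.ne', Real.log_pow, Real.log_mul (by norm_num) (by positivity), Real.log_pow] at h'
  rw [bs_eq hx hi, Real.log_div (by norm_num) hδ.ne']
  push_cast at h'
  linarith

lemma k_lo' (hδ : 0 < δ) (hD : δ ≤ (betaT β)^[n] x) {m : ℕ}
    (hmin : δ ≤ min (gaussMap^[m] x) (1 - gaussMap^[m] x))
    (hm : birkhoffSum gaussMap gf m x ≤ n * Real.log β / 2 + (-Real.log (4 / δ) / 2) - m * kap) :
    m ≤ kCF β n x := by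
  refine k_lo hβ hx hi hδ hD hmin ?_
  have hp : 0 < β ^ n := by positivity
  have hq := pd_pos hx hi m
  rw [← Real.log_le_log_iff (by positivity) (by positivity), Real.log_inv, Real.log_pow,
    Real.log_mul (by positivity) (by positivity), Real.log_mul (by norm_num) (by positivity), Real.log_pow,
    Real.log_div (by norm_num) (by norm_num), Real.log_one]
  rw [bs_eq hx hi, Real.log_div (by norm_num) hδ.ne'] at hm
  push_cast
  linarith
end

lemma rat_null : volume {x : ℝ | ¬ Irrational x} = 0 := by
  have : {x : ℝ | ¬ Irrational x} = Set.range ((↑) : ℚ → ℝ) := by ext x; simp [Irrational]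
  rw [this]
  exact (Set.countable_range _).measure_zero _

noncomputable def rn (a s : ℝ) (n : ℕ) : ℝ := a * n + s * Real.sqrt n
noncomputable def mn (a s : ℝ) (n : ℕ) : ℕ := ⌊rn a s n⌋₊ + 1

lemma sqrt_inv_t : Tendsto (fun n : ℕ => 1 / Real.sqrt n) atTop (nhds 0) := by
  refine Tendsto.const_div_atTop ?_ 1
  exact Real.tendsto_sqrt_atTop.comp tendsto_natCast_atTop_atTop

lemma rn_div (a s : ℝ) : Tendsto (fun n : ℕ => rn a s n / n) atTop (nhds a) := by
  have : Tendsto (fun n : ℕ => a + s * (1 / Real.sqrt n)) atTop (nhds (a + s * 0)) :=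
    tendsto_const_nhds.add (sqrt_inv_t.const_mul s)
  rw [mul_zero, add_zero] at this
  refine this.congr' ?_
  filter_upwards [eventually_gt_atTop 0] with n hn
  have hn' : (0:ℝ) < n := by exact_mod_cast hn
  have hs : 0 < Real.sqrt n := Real.sqrt_pos.2 hn'
  have e : (n:ℝ) = Real.sqrt n * Real.sqrt n := (Real.mul_self_sqrt hn'.le).symm
  unfold rn
  rw [add_div, mul_div_cancel_right₀ _ hn'.ne']
  congr 1
  rw [mul_one_div, div_eq_div_iff hs.ne' hn'.ne']
  linear_combination s * e

lemma rn_top {a : ℝ} (ha : 0 < a) (s : ℝ) : Tendsto (rn a s) atTop atTop := by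
  have h : Tendsto (fun n : ℕ => rn a s n / n * n) atTop atTop :=
    Tendsto.pos_mul_atTop ha (rn_div a s) tendsto_natCast_atTop_atTop
  refine h.congr' ?_
  filter_upwards [eventually_gt_atTop 0] with n hn
  have hn' : (0:ℝ) < n := by exact_mod_cast hn
  exact div_mul_cancel₀ _ hn'.ne'

lemma mn_top {a : ℝ} (ha : 0 < a) (s : ℝ) : Tendsto (mn a s) atTop atTop :=
  (tendsto_add_atTop_nat 1).comp (tendsto_nat_floor_atTop.comp (rn_top ha s))

lemma mn_bd {a s : ℝ} {n : ℕ} (h : 0 ≤ rn a s n) : rn a s n ≤ mn a s n ∧ (mn a s n : ℝ) ≤ rn a s n + 1 := by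
  unfold mn
  push_cast
  exact ⟨(Nat.lt_floor_add_one _).le, by linarith [Nat.floor_le h]⟩

lemma th_t {a : ℝ} (ha : 0 < a) (s : ℝ) :
    Tendsto (fun n : ℕ => ((mn a s n : ℝ) - rn a s n) / Real.sqrt n) atTop (nhds 0) := by
  refine tendsto_of_tendsto_of_tendsto_of_le_of_le' tendsto_const_nhds sqrt_inv_t ?_ ?_
  · filter_upwards [(rn_top ha s).eventually_ge_atTop 0] with n h
    have := (mn_bd h).1
    exact div_nonneg (by linarith) (Real.sqrt_nonneg _)
  · filter_upwards [(rn_top ha s).eventually_ge_atTop 0] with n h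
    have := (mn_bd h).2
    gcongr
    linarith

lemma mn_div {a : ℝ} (ha : 0 < a) (s : ℝ) : Tendsto (fun n : ℕ => (mn a s n : ℝ) / n) atTop (nhds a) := by
  have h : Tendsto (fun n : ℕ => rn a s n / n + ((mn a s n : ℝ) - rn a s n) / Real.sqrt n * (1 / Real.sqrt n))
      atTop (nhds (a + 0 * 0)) := (rn_div a s).add ((th_t ha s).mul sqrt_inv_t)
  rw [mul_zero, add_zero] at h
  refine h.congr' ?_
  filter_upwards [eventually_gt_atTop 0] with n hn
  have hn' : (0:ℝ) < n := by exact_mod_cast hn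
  rw [div_mul_div_comm, Real.mul_self_sqrt hn'.le]
  ring

lemma c_t {a v : ℝ} (ha : 0 < a) (hv : 0 < v) (K y : ℝ) :
    Tendsto (fun n : ℕ => (n * (a * kap) + K - mn a (Real.sqrt (a * v) / kap * y) n * kap) /
      Real.sqrt (v * mn a (Real.sqrt (a * v) / kap * y) n)) atTop (nhds (-y)) := by
  set s := Real.sqrt (a * v) / kap * y with hs
  have hk := kap_pos
  have hq : 0 < Real.sqrt (a * v) := Real.sqrt_pos.2 (by positivity)
  have h1 : Tendsto (fun n : ℕ => K * (1 / Real.sqrt n) - kap * s - kap * (((mn a s n : ℝ) - rn a s n) / Real.sqrt n))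
      atTop (nhds (K * 0 - kap * s - kap * 0)) :=
    ((sqrt_inv_t.const_mul K).sub tendsto_const_nhds).sub ((th_t ha s).const_mul kap)
  have h2 : Tendsto (fun n : ℕ => Real.sqrt (v * ((mn a s n : ℝ) / n))) atTop (nhds (Real.sqrt (v * a))) :=
    ((mn_div ha s).const_mul v).sqrt
  have h3 := h1.div h2 (by rw [mul_comm v a]; exact hq.ne')
  have e : (K * 0 - kap * s - kap * 0) / Real.sqrt (v * a) = -y := by
    rw [mul_comm v a, hs]; field_simp; ring
  rw [e] at h3
  refine h3.congr' ?_
  filter_upwards [eventually_gt_atTop 0] with n hn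
  have hn' : (0:ℝ) < n := by exact_mod_cast hn
  have hsn : 0 < Real.sqrt n := Real.sqrt_pos.2 hn'
  have e2 : Real.sqrt (v * ((mn a s n : ℝ) / n)) = Real.sqrt (v * mn a s n) / Real.sqrt n := by
    rw [← mul_div_assoc, Real.sqrt_div' _ hn'.le]
  simp only [Pi.div_apply]
  rw [e2, div_div_eq_mul_div]
  congr 1
  unfold rn
  field_simp
  ring

end KnCLT


namespace KnCLT

lemma low_bd {β : ℝ} (hβ : 1 < β) {δ : ℝ} (hδ : 0 < δ) (n m : ℕ) (q : ℝ) (hq : 0 < q) (A : Set ℝ)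
    (hA : ∀ x ∈ Ico (0:ℝ) 1, kCF β n x < m → x ∈ A) (hAs : A ⊆ Ico 0 1) :
    1 - β / (β - 1) * δ - volume.real {x ∈ Ioo (0:ℝ) 1 | birkhoffSum gaussMap gf m x / q ≤
      (n * Real.log β / 2 + Real.log (2 / δ) / 2 - m * kap) / q} ≤ (volume A).toReal := by
  set G := {x ∈ Ioo (0:ℝ) 1 | birkhoffSum gaussMap gf m x / q ≤
      (n * Real.log β / 2 + Real.log (2 / δ) / 2 - m * kap) / q} with hG
  have hb : 0 < β - 1 := by linarith
  have hsub : Ioo (0:ℝ) 1 ⊆ A ∪ ({x ∈ Ico (0:ℝ) 1 | (betaT β)^[n] x < δ} ∪ ({x : ℝ | ¬ Irrational x} ∪ G)) := by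
    intro x hx
    have hx' : x ∈ Ico (0:ℝ) 1 := ⟨hx.1.le, hx.2⟩
    by_cases hi : Irrational x
    swap
    · exact Or.inr (Or.inr (Or.inl hi))
    by_cases hD : (betaT β)^[n] x < δ
    · exact Or.inr (Or.inl ⟨hx', hD⟩)
    by_cases hk : kCF β n x < m
    · exact Or.inl (hA x hx' hk)
    refine Or.inr (Or.inr (Or.inr ⟨hx, ?_⟩))
    exact div_le_div_of_nonneg_right (k_up' hβ hx' hi hδ (not_lt.1 hD) (not_lt.1 hk)) hq.le
  have fA : volume A ≠ ⊤ := ((measure_mono hAs).trans_lt (by simp)).ne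
  have fG : volume G ≠ ⊤ := ((measure_mono (show G ⊆ Ioo (0:ℝ) 1 from fun x hx => hx.1)).trans_lt (by simp)).ne
  have h : (1 : ENNReal) ≤ volume A + (ENNReal.ofReal (β / (β - 1) * δ) + (0 + volume G)) := by
    calc (1 : ENNReal) = volume (Ioo (0:ℝ) 1) := by simp
      _ ≤ _ := measure_mono hsub
      _ ≤ _ := measure_union_le _ _
      _ ≤ _ := add_le_add le_rfl ((measure_union_le _ _).trans (add_le_add (beta_meas hβ n δ hδ.le)
          ((measure_union_le _ _).trans (add_le_add rat_null.le le_rfl))))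
  have h' := ENNReal.toReal_mono (by finiteness) h
  rw [zero_add, ENNReal.toReal_add fA (by finiteness), ENNReal.toReal_add (by finiteness) fG,
    ENNReal.toReal_ofReal (by positivity), ENNReal.toReal_one] at h'
  unfold Measure.real
  linarith

lemma up_bd {β : ℝ} (hβ : 1 < β) {δ : ℝ} (hδ : 0 < δ) (n m : ℕ) (q : ℝ) (hq : 0 < q) (A : Set ℝ)
    (hA : ∀ x ∈ A, x ∈ Ico (0:ℝ) 1 ∧ kCF β n x < m) :
    (volume A).toReal ≤ 1 + (β / (β - 1) * δ + 4 * δ) - volume.real {x ∈ Ioo (0:ℝ) 1 | birkhoffSum gaussMap gf m x / q ≤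
      (n * Real.log β / 2 + (-Real.log (4 / δ) / 2) - m * kap) / q} := by
  set G := {x ∈ Ioo (0:ℝ) 1 | birkhoffSum gaussMap gf m x / q ≤
      (n * Real.log β / 2 + (-Real.log (4 / δ) / 2) - m * kap) / q} with hG
  have mG : MeasurableSet G := measurableSet_Ioo.inter (measurableSet_le ((bs_meas m).div_const q) measurable_const)
  have hb : 0 < β - 1 := by linarith
  have sG : G ⊆ Ioo (0:ℝ) 1 := fun x hx => hx.1
  have hsub : A ⊆ (Ioo (0:ℝ) 1 \ G) ∪ ({x ∈ Ico (0:ℝ) 1 | (betaT β)^[n] x < δ} ∪ ({x : ℝ | ¬ Irrational x} ∪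
      {x ∈ Ioo (0:ℝ) 1 | min (gaussMap^[m] x) (1 - gaussMap^[m] x) < δ})) := by
    intro x hxA
    obtain ⟨hx, hk⟩ := hA x hxA
    by_cases hi : Irrational x
    swap
    · exact Or.inr (Or.inr (Or.inl hi))
    have hx' : x ∈ Ioo (0:ℝ) 1 := g_iter_pos hx hi 0
    by_cases hD : (betaT β)^[n] x < δ
    · exact Or.inr (Or.inl ⟨hx, hD⟩)
    by_cases hmin : min (gaussMap^[m] x) (1 - gaussMap^[m] x) < δ
    · exact Or.inr (Or.inr (Or.inr ⟨hx', hmin⟩))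
    refine Or.inl ⟨hx', fun hg => ?_⟩
    have := k_lo' hβ hx hi hδ (not_lt.1 hD) (not_lt.1 hmin) ((div_le_div_iff_of_pos_right hq).1 hg.2)
    omega
  have fG : volume G ≠ ⊤ := ((measure_mono sG).trans_lt (by simp)).ne
  have fD : volume (Ioo (0:ℝ) 1 \ G) ≠ ⊤ := ((measure_mono diff_subset).trans_lt (by simp : volume (Ioo (0:ℝ) 1) < ⊤)).ne
  have h : volume A ≤ volume (Ioo (0:ℝ) 1 \ G) + (ENNReal.ofReal (β / (β - 1) * δ) + (0 + ENNReal.ofReal (4 * δ))) := by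
    calc _ ≤ _ := measure_mono hsub
      _ ≤ _ := measure_union_le _ _
      _ ≤ _ := add_le_add le_rfl ((measure_union_le _ _).trans (add_le_add (beta_meas hβ n δ hδ.le)
          ((measure_union_le _ _).trans (add_le_add rat_null.le (gauss_min m δ hδ.le)))))
  have h' := ENNReal.toReal_mono (by finiteness) h
  rw [zero_add, ENNReal.toReal_add fD (by finiteness), ENNReal.toReal_add (by finiteness) (by finiteness),
    ENNReal.toReal_ofReal (by positivity), ENNReal.toReal_ofReal (by positivity),
    measure_diff sG mG.nullMeasurableSet fG, ENNReal.toReal_sub_of_le (measure_mono sG) (by simp)] at h'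
  have one : (volume (Ioo (0:ℝ) 1)).toReal = 1 := by simp
  rw [one] at h'
  unfold Measure.real
  linarith

end KnCLT

theorem clt_for_kn (β : ℝ) (hβ : 1 < β) :
    ∃ σ : ℝ, 0 < σ ∧ ∀ y : ℝ,
      Tendsto (fun n : ℕ =>
          (volume {x ∈ Set.Ico (0:ℝ) 1 |
            ((kCF β n x : ℝ) - (6 * Real.log 2 * Real.log β / Real.pi ^ 2) * n) /
              (σ * Real.sqrt n) ≤ y}).toReal)
        atTop (nhds ((1 / Real.sqrt (2 * Real.pi)) * ∫ t in Set.Iic y, Real.exp (-t ^ 2 / 2))) := by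
  obtain ⟨v, hv, hclt⟩ := KnCLT.gauss_clt
  have hk := KnCLT.kap_pos
  have hlb : 0 < Real.log β := Real.log_pos hβ
  have hl2 := KnCLT.log2_pos
  have hpi := Real.pi_pos
  have hb : 0 < β - 1 := by linarith
  set a := 6 * Real.log 2 * Real.log β / Real.pi ^ 2 with ha_def
  have ha : 0 < a := by positivity
  have hak : a * KnCLT.kap = Real.log β / 2 := by
    rw [ha_def]; unfold KnCLT.kap; field_simp; norm_num
  have hσ : 0 < Real.sqrt (a * v) / KnCLT.kap := div_pos (Real.sqrt_pos.2 (by positivity)) hk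
  refine ⟨Real.sqrt (a * v) / KnCLT.kap, hσ, fun y => ?_⟩
  rw [← KnCLT.Phi_eq]
  set σ := Real.sqrt (a * v) / KnCLT.kap with hσd
  set m := KnCLT.mn a (σ * y) with hm
  have hmt : Tendsto m atTop atTop := KnCLT.mn_top ha _
  have key : ∀ K : ℝ, Tendsto (fun n => volume.real {x ∈ Ioo (0:ℝ) 1 | birkhoffSum gaussMap KnCLT.gf (m n) x /
      Real.sqrt (v * m n) ≤ (n * Real.log β / 2 + K - m n * KnCLT.kap) / Real.sqrt (v * m n)}) atTop
      (nhds (1 - KnCLT.Phi y)) := by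
    intro K
    rw [← KnCLT.Phi_neg]
    refine hclt m _ _ hmt ?_
    have := KnCLT.c_t ha hv K y
    refine this.congr fun n => ?_
    rw [hak, mul_div_assoc]
  rw [Metric.tendsto_atTop']
  intro ε hε
  set C := β / (β - 1) + 4 with hC
  have hCp : 0 < C := by positivity
  set δ := ε / (2 * C) with hδ
  have hδp : 0 < δ := by positivity
  have hCδ : β / (β - 1) * δ + 4 * δ = ε / 2 := by
    rw [← add_mul, ← hC, hδ]; field_simp
  have e1 := (key (Real.log (2 / δ) / 2)).eventually_lt_const (show 1 - KnCLT.Phi y < 1 - KnCLT.Phi y + ε / 2 by linarith)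
  have e2 := (key (-Real.log (4 / δ) / 2)).eventually_const_lt (show 1 - KnCLT.Phi y - ε / 2 < 1 - KnCLT.Phi y by linarith)
  have hev : ∀ᶠ n : ℕ in atTop, dist ((volume {x ∈ Set.Ico (0:ℝ) 1 |
            ((kCF β n x : ℝ) - a * n) / (σ * Real.sqrt n) ≤ y}).toReal) (KnCLT.Phi y) < ε := by
    filter_upwards [e1, e2, eventually_gt_atTop 0, (KnCLT.rn_top ha (σ * y)).eventually_ge_atTop 0] with n h1 h2 hn hr
    have hn' : (0:ℝ) < n := by exact_mod_cast hn
    have hsn : 0 < Real.sqrt n := Real.sqrt_pos.2 hn'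
    have hmp : 0 < m n := by rw [hm]; exact Nat.succ_pos _
    have hmp' : (0:ℝ) < m n := by exact_mod_cast hmp
    have hq : 0 < Real.sqrt (v * m n) := Real.sqrt_pos.2 (by positivity)
    have iff : ∀ x, ((kCF β n x : ℝ) - a * n) / (σ * Real.sqrt n) ≤ y ↔ kCF β n x < m n := by
      intro x
      rw [div_le_iff₀ (by positivity), hm]
      unfold KnCLT.mn
      rw [Nat.lt_succ_iff, Nat.le_floor_iff hr]
      unfold KnCLT.rn
      constructor <;> intro h <;> linarith
    have l := KnCLT.low_bd hβ hδp n (m n) _ hq {x ∈ Set.Ico (0:ℝ) 1 |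
            ((kCF β n x : ℝ) - a * n) / (σ * Real.sqrt n) ≤ y} (fun x hx h => ⟨hx, (iff x).2 h⟩) (fun x hx => hx.1)
    have u := KnCLT.up_bd hβ hδp n (m n) _ hq {x ∈ Set.Ico (0:ℝ) 1 |
            ((kCF β n x : ℝ) - a * n) / (σ * Real.sqrt n) ≤ y} (fun x hx => ⟨hx.1, (iff x).1 hx.2⟩)
    rw [Real.dist_eq, abs_lt]
    constructor <;> linarith
  obtain ⟨N, hN⟩ := eventually_atTop.1 hev
  exact ⟨N, fun n hn => hN n hn.le⟩
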